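/- Let p_{Y1,Y2|X} be a discrete memoryless broadcast channel with binary input whose marginal channel p_{Y1|X} is a binary symmetric channel with crossover probability p ∈ [0,1/2] and whose marginal channel p_{Y2|X} is a binary erasure channel with erasure probability ε ∈ [0,1]. Then: (i) if ε ∈ [0, 4p(1−p)], 𝒞₂(p_{Y1,Y2|X}) = 𝒞(p_{Y1,Y2|X}); (ii) if ε ∈ (4p(1−p), 1) and p ≠ 0, then 𝒞₂(p_{Y1,Y2|X}) equals the union of {(R1,R2) ∈ ℝ²₊ : R1 ≤ 1 − H_b(α*p), R2 ≤ (1−ε)H_b(α)} over α ∈ [0, α̃], together with the set {(R1,R2) ∈ ℝ²₊ : R1 ≤ 1 − H_b(α̃*p), R2 ≤ 1−ε, R1+R2 ≤ 1 − H_b(α̃*p) + (1−ε)H_b(α̃)}, where α̃ is the unique number in (0,1/2) satisfying (1−2p)·log₂((1−α̃*p)/(α̃*p)) = (1−ε)·log₂((1−α̃)/α̃); (iii) if ε = 1 or p = 0, 𝒞₂(p_{Y1,Y2|X}) = {(R1,R2) ∈ ℝ²₊ : R2 ≤ 1−ε and R1+R2 ≤ 1 − H_b(p)}. -/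

import Mathlib

open scoped BigOperators Classical
open Finset

noncomputable section

/-- `p` is a probability mass function on the finite type `α`. -/
def IsPMF {α : Type} [Fintype α] (p : α → ℝ) : Prop :=
  (∀ a, 0 ≤ p a) ∧ ∑ a, p a = 1

/-- Shannon entropy (base 2) of a pmf on a finite type. -/
def Hent {α : Type} [Fintype α] (p : α → ℝ) : ℝ :=
  -∑ a, p a * Real.logb 2 (p a)

/-- Mutual information `I(A;B)` of a joint pmf on `α × β` (base-2 logarithms). -/
def MI {α β : Type} [Fintype α] [Fintype β] (p : α × β → ℝ) : ℝ :=
  Hent (fun a => ∑ b, p (a, b)) + Hent (fun b => ∑ a, p (a, b)) - Hent p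

/-- Conditional mutual information `I(A;B|C)` of a joint pmf on `α × β × γ`. -/
def CMI {α β γ : Type} [Fintype α] [Fintype β] [Fintype γ] (p : α × β × γ → ℝ) : ℝ :=
  Hent (fun ac : α × γ => ∑ b, p (ac.1, b, ac.2))
    + Hent (fun bc : β × γ => ∑ a, p (a, bc.1, bc.2))
    - Hent p
    - Hent (fun c : γ => ∑ a, ∑ b, p (a, b, c))

/-- A channel: every input letter gives a pmf on outputs. -/
def IsChannel {X Z : Type} [Fintype Z] (W : X → Z → ℝ) : Prop :=
  ∀ x, IsPMF (W x)

/-- Marginal channel to receiver 1 of a broadcast channel. -/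
def margW1 {X Y1 Y2 : Type} [Fintype Y2] (W : X → Y1 × Y2 → ℝ) : X → Y1 → ℝ :=
  fun x y1 => ∑ y2, W x (y1, y2)

/-- Marginal channel to receiver 2 of a broadcast channel. -/
def margW2 {X Y1 Y2 : Type} [Fintype Y1] (W : X → Y1 × Y2 → ℝ) : X → Y2 → ℝ :=
  fun x y2 => ∑ y1, W x (y1, y2)

/-- Memoryless `n`-fold extension of a broadcast channel. -/
def nFold {X Y1 Y2 : Type} (W : X → Y1 × Y2 → ℝ) (n : ℕ)
    (x : Fin n → X) (y : (Fin n → Y1) × (Fin n → Y2)) : ℝ :=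
  ∏ t, W (x t) (y.1 t, y.2 t)

section Channel

variable {X Y1 Y2 : Type} [Fintype Y1] [Fintype Y2]

/-- Average error probability; message `M2` known at receiver 1. -/
def errP1 (W : X → Y1 × Y2 → ℝ) (n k1 k2 : ℕ) (f : Fin k1 × Fin k2 → Fin n → X)
    (g1 : (Fin n → Y1) × Fin k2 → Fin k1) (g2 : (Fin n → Y2) → Fin k2) : ℝ :=
  (1 : ℝ) / ((k1 : ℝ) * (k2 : ℝ)) *
    ∑ m : Fin k1 × Fin k2, ∑ y : (Fin n → Y1) × (Fin n → Y2),
      nFold W n (f m) y * (if g1 (y.1, m.2) = m.1 ∧ g2 y.2 = m.2 then 0 else 1)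

/-- Average error probability; message `M1` known at receiver 2. -/
def errP2 (W : X → Y1 × Y2 → ℝ) (n k1 k2 : ℕ) (f : Fin k1 × Fin k2 → Fin n → X)
    (g1 : (Fin n → Y1) → Fin k1) (g2 : (Fin n → Y2) × Fin k1 → Fin k2) : ℝ :=
  (1 : ℝ) / ((k1 : ℝ) * (k2 : ℝ)) *
    ∑ m : Fin k1 × Fin k2, ∑ y : (Fin n → Y1) × (Fin n → Y2),
      nFold W n (f m) y * (if g1 y.1 = m.1 ∧ g2 (y.2, m.1) = m.2 then 0 else 1)

/-- Average error probability; no receiver side information. -/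
def errP0 (W : X → Y1 × Y2 → ℝ) (n k1 k2 : ℕ) (f : Fin k1 × Fin k2 → Fin n → X)
    (g1 : (Fin n → Y1) → Fin k1) (g2 : (Fin n → Y2) → Fin k2) : ℝ :=
  (1 : ℝ) / ((k1 : ℝ) * (k2 : ℝ)) *
    ∑ m : Fin k1 × Fin k2, ∑ y : (Fin n → Y1) × (Fin n → Y2),
      nFold W n (f m) y * (if g1 y.1 = m.1 ∧ g2 y.2 = m.2 then 0 else 1)

/-- Achievability of a rate pair with `M2` available at receiver 1. -/
def Ach1 (W : X → Y1 × Y2 → ℝ) (R : ℝ × ℝ) : Prop :=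
  0 ≤ R.1 ∧ 0 ≤ R.2 ∧ ∀ ε : ℝ, 0 < ε →
    ∃ (n k1 k2 : ℕ), 0 < n ∧ 0 < k1 ∧ 0 < k2 ∧
      ∃ (f : Fin k1 × Fin k2 → Fin n → X) (g1 : (Fin n → Y1) × Fin k2 → Fin k1)
        (g2 : (Fin n → Y2) → Fin k2),
        R.1 ≤ Real.logb 2 (k1 : ℝ) / (n : ℝ) ∧ R.2 ≤ Real.logb 2 (k2 : ℝ) / (n : ℝ) ∧
        errP1 W n k1 k2 f g1 g2 ≤ ε

/-- Achievability of a rate pair with `M1` available at receiver 2. -/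
def Ach2 (W : X → Y1 × Y2 → ℝ) (R : ℝ × ℝ) : Prop :=
  0 ≤ R.1 ∧ 0 ≤ R.2 ∧ ∀ ε : ℝ, 0 < ε →
    ∃ (n k1 k2 : ℕ), 0 < n ∧ 0 < k1 ∧ 0 < k2 ∧
      ∃ (f : Fin k1 × Fin k2 → Fin n → X) (g1 : (Fin n → Y1) → Fin k1)
        (g2 : (Fin n → Y2) × Fin k1 → Fin k2),
        R.1 ≤ Real.logb 2 (k1 : ℝ) / (n : ℝ) ∧ R.2 ≤ Real.logb 2 (k2 : ℝ) / (n : ℝ) ∧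
        errP2 W n k1 k2 f g1 g2 ≤ ε

/-- Achievability of a rate pair with no receiver side information. -/
def Ach0 (W : X → Y1 × Y2 → ℝ) (R : ℝ × ℝ) : Prop :=
  0 ≤ R.1 ∧ 0 ≤ R.2 ∧ ∀ ε : ℝ, 0 < ε →
    ∃ (n k1 k2 : ℕ), 0 < n ∧ 0 < k1 ∧ 0 < k2 ∧
      ∃ (f : Fin k1 × Fin k2 → Fin n → X) (g1 : (Fin n → Y1) → Fin k1)
        (g2 : (Fin n → Y2) → Fin k2),
        R.1 ≤ Real.logb 2 (k1 : ℝ) / (n : ℝ) ∧ R.2 ≤ Real.logb 2 (k2 : ℝ) / (n : ℝ) ∧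
        errP0 W n k1 k2 f g1 g2 ≤ ε

/-- Capacity region `𝒞₁`: side information `M2` at receiver 1. -/
def Cap1 (W : X → Y1 × Y2 → ℝ) : Set (ℝ × ℝ) := closure {R | Ach1 W R}

/-- Capacity region `𝒞₂`: side information `M1` at receiver 2. -/
def Cap2 (W : X → Y1 × Y2 → ℝ) : Set (ℝ × ℝ) := closure {R | Ach2 W R}

/-- Private-message capacity region `𝒞`. -/
def Cap (W : X → Y1 × Y2 → ℝ) : Set (ℝ × ℝ) := closure {R | Ach0 W R}

end Channel

/-- `κ·𝒜` for a set of rate pairs. -/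
def scaleSet (κ : ℝ) (A : Set (ℝ × ℝ)) : Set (ℝ × ℝ) :=
  (fun R : ℝ × ℝ => (κ * R.1, κ * R.2)) '' A

/-- Binary entropy function (base 2). -/
def Hb (x : ℝ) : ℝ := -(x * Real.logb 2 x) - (1 - x) * Real.logb 2 (1 - x)

/-- Binary convolution `a*b = a(1-b)+(1-a)b`. -/
def bconv (a b : ℝ) : ℝ := a * (1 - b) + (1 - a) * b

/-- The region `𝒞(BS-BC(d₁,d₂))`. -/
def CBSBC (d1 d2 : ℝ) : Set (ℝ × ℝ) :=
  {R | 0 ≤ R.1 ∧ 0 ≤ R.2 ∧ ∃ α ∈ Set.Icc (0:ℝ) (1/2),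
    R.1 ≤ Hb (bconv α d1) - Hb d1 ∧ R.2 ≤ 1 - Hb (bconv α d2)}

/-- The region `𝒞(BE-BC(ε₁,ε₂))`. -/
def CBEBC (e1 e2 : ℝ) : Set (ℝ × ℝ) :=
  {R | 0 ≤ R.1 ∧ 0 ≤ R.2 ∧ ∃ β ∈ Set.Icc (0:ℝ) 1,
    R.1 ≤ β * (1 - e1) ∧ R.2 ≤ (1 - β) * (1 - e2)}

/-- 1-norm distance between two functions on a finite type. -/
def l1dist {α : Type} [Fintype α] (p q : α → ℝ) : ℝ := ∑ a, |p a - q a|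

/-- Capacity `C(p_{Y|X}) = max_{p_X} I(X;Y)` of a point-to-point channel. -/
def Cmarg {X Y : Type} [Fintype X] [Fintype Y] (Wm : X → Y → ℝ) : ℝ :=
  sSup {r | ∃ pX : X → ℝ, IsPMF pX ∧ r = MI (fun a : X × Y => pX a.1 * Wm a.1 a.2)}

/-- Transition kernel of the binary symmetric channel `BSC(p)`. -/
def BSCk (p : ℝ) : Bool → Bool → ℝ := fun x y => if y = x then 1 - p else p

/-- Transition kernel of the binary erasure channel `BEC(ε)`
(`none` is the erasure symbol). -/
def BECk (e : ℝ) : Bool → Option Bool → ℝ :=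
  fun x y => match y with
    | none => e
    | some b => if b = x then 1 - e else 0

/-- Homogeneous entropy (nats) of a nonnegative function. -/
def Ent {α : Type} [Fintype α] (μ : α → ℝ) : ℝ :=
  ∑ a, Real.negMulLog (μ a) - Real.negMulLog (∑ a, μ a)

/-- Output measure of a channel. -/
def push {X Y : Type} [Fintype X] (μ : X → ℝ) (W : X → Y → ℝ) : Y → ℝ :=
  fun y => ∑ x, μ x * W x y

theorem gibbs_pt {p q : ℝ} (hp : 0 ≤ p) (hq : 0 ≤ q) (h : q = 0 → p = 0) :
    p * Real.log q ≤ p * Real.log p + (q - p) := by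
  rcases hp.eq_or_lt with rfl | hp
  · simpa using hq
  have hq' : 0 < q := lt_of_le_of_ne hq (fun h0 => hp.ne' (h h0.symm))
  have h1 := Real.log_le_sub_one_of_pos (div_pos hq' hp)
  rw [Real.log_div hq'.ne' hp.ne'] at h1
  have h2 := mul_le_mul_of_nonneg_left h1 hp.le
  have : p * (q / p - 1) = q - p := by field_simp
  nlinarith

theorem Ent_chain {A B : Type} [Fintype A] [Fintype B] (P : A → B → ℝ) :
    Ent (fun ab : A × B => P ab.1 ab.2)
      = Ent (fun b => ∑ a, P a b) + ∑ b, Ent (fun a => P a b) := by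
  unfold Ent
  rw [Fintype.sum_prod_type, Fintype.sum_prod_type, Finset.sum_sub_distrib,
    Finset.sum_comm, Finset.sum_comm (f := fun a b => P a b)]
  ring

theorem Ent_chain' {A B : Type} [Fintype A] [Fintype B] (P : A → B → ℝ) :
    Ent (fun ab : A × B => P ab.1 ab.2)
      = Ent (fun a => ∑ b, P a b) + ∑ a, Ent (fun b => P a b) := by
  unfold Ent
  rw [Fintype.sum_prod_type, Fintype.sum_prod_type, Finset.sum_sub_distrib]
  ring

theorem Ent_superadd {A B : Type} [Fintype A] [Fintype B] (P : A → B → ℝ)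
    (hP : ∀ a b, 0 ≤ P a b) :
    ∑ b, Ent (fun a => P a b) ≤ Ent (fun a => ∑ b, P a b) := by
  set PA : A → ℝ := fun a => ∑ b, P a b with hPA
  set PB : B → ℝ := fun b => ∑ a, P a b with hPB
  set T : ℝ := ∑ a, PA a with hT
  have hPA0 : ∀ a, 0 ≤ PA a := fun a => Finset.sum_nonneg fun b _ => hP a b
  have hPB0 : ∀ b, 0 ≤ PB b := fun b => Finset.sum_nonneg fun a _ => hP a b
  have hTB : T = ∑ b, PB b := by rw [hT, hPA, hPB]; exact Finset.sum_comm
  have hT0 : 0 ≤ T := Finset.sum_nonneg fun a _ => hPA0 a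
  have leA : ∀ a b, P a b ≤ PA a := fun a b =>
    Finset.single_le_sum (f := fun b => P a b) (fun b _ => hP a b) (Finset.mem_univ b)
  have leB : ∀ a b, P a b ≤ PB b := fun a b =>
    Finset.single_le_sum (f := fun a => P a b) (fun a _ => hP a b) (Finset.mem_univ a)
  have leT : ∀ a, PA a ≤ T := fun a =>
    Finset.single_le_sum (f := PA) (fun a _ => hPA0 a) (Finset.mem_univ a)
  have key : ∀ a b, P a b * Real.log (PA a) + P a b * Real.log (PB b)
      - P a b * Real.log T ≤ P a b * Real.log (P a b) + (PA a * PB b / T - P a b) := by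
    intro a b
    rcases (hP a b).eq_or_lt with h0 | h0
    · rw [← h0]
      have : 0 ≤ PA a * PB b / T := div_nonneg (mul_nonneg (hPA0 a) (hPB0 b)) hT0
      simpa using this
    · have ha : 0 < PA a := h0.trans_le (leA a b)
      have hb : 0 < PB b := h0.trans_le (leB a b)
      have ht : 0 < T := ha.trans_le (leT a)
      have hq : 0 < PA a * PB b / T := by positivity
      have := gibbs_pt h0.le hq.le (fun h => absurd h hq.ne')
      rw [Real.log_div (by positivity) ht.ne', Real.log_mul ha.ne' hb.ne'] at this
      linarith
  have hs : ∑ a, ∑ b, (PA a * PB b / T - P a b) = 0 := by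
    simp only [Finset.sum_sub_distrib]
    have : ∑ a, ∑ b, PA a * PB b / T = T * T / T := by
      have : ∀ a, ∑ b, PA a * PB b / T = PA a * T / T := by
        intro a
        rw [← Finset.sum_div, ← Finset.mul_sum, ← hTB]
      simp only [this]
      rw [← Finset.sum_div, ← Finset.sum_mul]
    rw [this]
    have h2 : ∑ a, ∑ b, P a b = T := rfl
    rw [h2]
    by_cases h : T = 0
    · simp [h]
    · field_simp; ring
  have sum := Finset.sum_le_sum (fun a (_ : a ∈ Finset.univ) =>
    Finset.sum_le_sum (fun b (_ : b ∈ Finset.univ) => key a b))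
  have e1 : ∑ a, ∑ b, (P a b * Real.log (PA a) + P a b * Real.log (PB b)
      - P a b * Real.log T) = ∑ a, PA a * Real.log (PA a) + ∑ b, PB b * Real.log (PB b)
        - T * Real.log T := by
    simp only [Finset.sum_add_distrib, Finset.sum_sub_distrib]
    congr 1
    · congr 1
      · simp only [← Finset.sum_mul, hPA]
      · rw [Finset.sum_comm]
        simp only [← Finset.sum_mul, hPB]
    · simp only [← Finset.sum_mul]
      rfl
  have e2 : ∑ a, ∑ b, (P a b * Real.log (P a b) + (PA a * PB b / T - P a b))
      = ∑ a, ∑ b, P a b * Real.log (P a b) := by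
    simp only [Finset.sum_add_distrib] at hs ⊢
    rw [hs, add_zero]
  rw [e1, e2] at sum
  unfold Ent Real.negMulLog
  simp only [Finset.sum_sub_distrib, neg_mul, Finset.sum_neg_distrib]
  rw [Finset.sum_comm (f := fun b a => P a b * Real.log (P a b))]
  change -∑ a, ∑ b, P a b * Real.log (P a b) - -∑ b, PB b * Real.log (PB b)
    ≤ -∑ a, PA a * Real.log (PA a) - -(T * Real.log T)
  linarith

theorem Ent_equiv {A B : Type} [Fintype A] [Fintype B] (e : A ≃ B) (μ : B → ℝ) :
    Ent (fun a => μ (e a)) = Ent μ := by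
  unfold Ent
  rw [Equiv.sum_comp e (fun b => Real.negMulLog (μ b)), Equiv.sum_comp e μ]

theorem Ent_unique {A : Type} [Fintype A] [Unique A] (μ : A → ℝ) : Ent μ = 0 := by
  unfold Ent; simp

theorem Ent_smul {A : Type} [Fintype A] (c : ℝ) (μ : A → ℝ) :
    Ent (fun a => c * μ a) = c * Ent μ := by
  unfold Ent
  rw [← Finset.mul_sum, Real.negMulLog_mul, mul_sub, Finset.mul_sum]
  simp only [Real.negMulLog_mul, Finset.sum_add_distrib, ← Finset.sum_mul]
  ring

section tensor
variable {A A1 A2 B B1 B2 : Type} [Fintype A] [Fintype A1] [Fintype A2]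
  [Fintype B] [Fintype B1] [Fintype B2]

theorem push_sum {X Y : Type} [Fintype X] [Fintype Y] (μ : X → ℝ) (W : X → Y → ℝ)
    (hW : ∀ x, ∑ y, W x y = 1) : ∑ y, push μ W y = ∑ x, μ x := by
  unfold push
  rw [Finset.sum_comm]
  simp only [← Finset.mul_sum, hW, mul_one]

theorem tensor (W1 : A → A1 → ℝ) (W2 : A → A2 → ℝ) (V1 : B → B1 → ℝ) (V2 : B → B2 → ℝ)
    (hW1 : IsChannel W1) (hW2 : IsChannel W2) (hV1 : IsChannel V1) (hV2 : IsChannel V2)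
    (l CA CB : ℝ) (hl : 1 ≤ l)
    (hA : ∀ μ : A → ℝ, (∀ a, 0 ≤ μ a) →
      Ent (push μ W2) - l * Ent (push μ W1) ≤ CA * ∑ a, μ a)
    (hB : ∀ μ : B → ℝ, (∀ a, 0 ≤ μ a) →
      Ent (push μ V2) - l * Ent (push μ V1) ≤ CB * ∑ a, μ a)
    (Q : A × B → ℝ) (hQ : ∀ x, 0 ≤ Q x) :
    Ent (push Q (fun x (y : A2 × B2) => W2 x.1 y.1 * V2 x.2 y.2))
      - l * Ent (push Q (fun x (y : A1 × B1) => W1 x.1 y.1 * V1 x.2 y.2))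
      ≤ (CA + CB) * ∑ x, Q x := by
  set μ : B2 → A → ℝ := fun b2 a => ∑ b, Q (a, b) * V2 b b2 with hμ
  set ν : A1 → B → ℝ := fun a1 b => ∑ a, Q (a, b) * W1 a a1 with hν
  have hμ0 : ∀ b2 a, 0 ≤ μ b2 a := fun b2 a =>
    Finset.sum_nonneg fun b _ => mul_nonneg (hQ _) ((hV2 b).1 b2)
  have hν0 : ∀ a1 b, 0 ≤ ν a1 b := fun a1 b =>
    Finset.sum_nonneg fun a _ => mul_nonneg (hQ _) ((hW1 a).1 a1)
  have hμs : ∑ b2, ∑ a, μ b2 a = ∑ x, Q x := by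
    rw [Finset.sum_comm, Fintype.sum_prod_type]
    refine Finset.sum_congr rfl fun a _ => ?_
    exact push_sum (fun b => Q (a, b)) V2 (fun b => (hV2 b).2)
  have hνs : ∑ a1, ∑ b, ν a1 b = ∑ x, Q x := by
    rw [Finset.sum_comm, Fintype.sum_prod_type_right]
    refine Finset.sum_congr rfl fun b _ => ?_
    exact push_sum (fun a => Q (a, b)) W1 (fun b => (hW1 b).2)
  have c22 := Ent_chain (fun (a2 : A2) (b2 : B2) => push (μ b2) W2 a2)
  have c12 := Ent_chain (fun (a1 : A1) (b2 : B2) => push (μ b2) W1 a1)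
  have c12' := Ent_chain' (fun (a1 : A1) (b2 : B2) => push (ν a1) V2 b2)
  have c11 := Ent_chain' (fun (a1 : A1) (b1 : B1) => push (ν a1) V1 b1)
  have e22 : push Q (fun x (y : A2 × B2) => W2 x.1 y.1 * V2 x.2 y.2)
      = fun ab : A2 × B2 => push (μ ab.2) W2 ab.1 := by
    funext y
    simp only [push, hμ, Fintype.sum_prod_type, Finset.sum_mul]
    exact Finset.sum_congr rfl fun a _ => Finset.sum_congr rfl fun b _ => by ring
  have e11 : push Q (fun x (y : A1 × B1) => W1 x.1 y.1 * V1 x.2 y.2)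
      = fun ab : A1 × B1 => push (ν ab.1) V1 ab.2 := by
    funext y
    simp only [push, hν, Fintype.sum_prod_type, Finset.sum_mul]
    rw [Finset.sum_comm]
    exact Finset.sum_congr rfl fun a _ => Finset.sum_congr rfl fun b _ => by ring
  have e12 : (fun ab : A1 × B2 => push (μ ab.2) W1 ab.1)
      = fun ab : A1 × B2 => push (ν ab.1) V2 ab.2 := by
    funext y
    simp only [push, hμ, hν, Finset.sum_mul]
    rw [Finset.sum_comm]
    exact Finset.sum_congr rfl fun a _ => Finset.sum_congr rfl fun b _ => by ring
  rw [e22, e11]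
  simp only [push_sum _ W1 (fun b => (hW1 b).2), push_sum _ W2 (fun b => (hW2 b).2)] at c22 c12
  simp only [push_sum _ V1 (fun b => (hV1 b).2), push_sum _ V2 (fun b => (hV2 b).2)] at c12' c11
  rw [e12] at c12
  have sup := Ent_superadd (fun (a1 : A1) (b2 : B2) => push (μ b2) W1 a1)
    (fun a1 b2 => Finset.sum_nonneg fun a _ => mul_nonneg (hμ0 _ _) ((hW1 a).1 a1))
  have marg : (fun a1 => ∑ b2, push (μ b2) W1 a1) = fun a1 => ∑ b, ν a1 b := by
    funext a1
    have := congrFun e12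
    simp only [fun b2 => this (a1, b2)]
    exact push_sum _ V2 (fun b => (hV2 b).2)
  rw [marg] at sup
  have sA : ∑ b2, Ent (push (μ b2) W2) - l * ∑ b2, Ent (push (μ b2) W1) ≤ CA * ∑ x, Q x := by
    rw [← hμs, Finset.mul_sum, Finset.mul_sum, ← Finset.sum_sub_distrib]
    exact Finset.sum_le_sum fun b2 _ => hA _ (hμ0 b2)
  have sB : ∑ b2, Ent (push (ν b2) V2) - l * ∑ b2, Ent (push (ν b2) V1) ≤ CB * ∑ x, Q x := by
    rw [← hνs, Finset.mul_sum, Finset.mul_sum, ← Finset.sum_sub_distrib]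
    exact Finset.sum_le_sum fun b2 _ => hB _ (hν0 b2)
  have h3 : 0 ≤ (l - 1) * (Ent (fun a1 => ∑ b, ν a1 b) - ∑ b2, Ent (push (μ b2) W1)) :=
    mul_nonneg (by linarith) (by
      have : ∑ b2, Ent (push (μ b2) W1) = ∑ b, Ent fun a => push (μ b) W1 a := rfl
      linarith)
  have r1 : ∀ b, (fun a => push (μ b) W1 a) = push (μ b) W1 := fun _ => rfl
  have r2 : ∀ b, (fun a => push (μ b) W2 a) = push (μ b) W2 := fun _ => rfl
  have r3 : ∀ b, (fun a => push (ν b) V1 a) = push (ν b) V1 := fun _ => rfl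
  have r4 : ∀ b, (fun a => push (ν b) V2 a) = push (ν b) V2 := fun _ => rfl
  simp only [r1, r2, r3, r4] at c22 c12 c12' c11 sup
  rw [c22, c11]
  nlinarith
end tensor

/-- n-fold product channel -/
def Wn {X Y : Type} (W : X → Y → ℝ) (n : ℕ) (x : Fin n → X) (y : Fin n → Y) : ℝ :=
  ∏ t, W (x t) (y t)

theorem Wn_channel {X Y : Type} [Fintype Y] {W : X → Y → ℝ} (hW : IsChannel W) (n : ℕ) :
    IsChannel (Wn W n) := by
  intro x
  refine ⟨fun y => Finset.prod_nonneg fun t _ => (hW _).1 _, ?_⟩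
  unfold Wn
  have := Finset.prod_univ_sum (fun _ : Fin n => (Finset.univ : Finset Y))
    (fun t y => W (x t) y)
  rw [Fintype.piFinset_univ] at this
  rw [← this]
  exact Finset.prod_eq_one fun t _ => (hW _).2

theorem tensor_n {X Y1 Y2 : Type} [Fintype X] [Fintype Y1] [Fintype Y2]
    (W1 : X → Y1 → ℝ) (W2 : X → Y2 → ℝ) (hW1 : IsChannel W1) (hW2 : IsChannel W2)
    (l C : ℝ) (hl : 1 ≤ l)
    (hA : ∀ μ : X → ℝ, (∀ a, 0 ≤ μ a) →
      Ent (push μ W2) - l * Ent (push μ W1) ≤ C * ∑ a, μ a) (n : ℕ) :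
    ∀ Q : (Fin n → X) → ℝ, (∀ x, 0 ≤ Q x) →
      Ent (push Q (Wn W2 n)) - l * Ent (push Q (Wn W1 n)) ≤ (n * C) * ∑ x, Q x := by
  induction n with
  | zero =>
    intro Q hQ
    rw [Ent_unique, Ent_unique]; simp
  | succ n ih =>
    intro Q hQ
    have h := tensor W1 W2 (Wn W1 n) (Wn W2 n) hW1 hW2 (Wn_channel hW1 n) (Wn_channel hW2 n)
      l C (n * C) hl hA ih (fun x => Q (Fin.consEquiv (fun _ => X) x)) (fun x => hQ _)
    have e : ∀ {Y : Type} [Fintype Y] (W : X → Y → ℝ),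
        Ent (push Q (Wn W (n+1))) = Ent (push (fun x => Q (Fin.consEquiv (fun _ => X) x))
          (fun x (y : Y × (Fin n → Y)) => W x.1 y.1 * Wn W n x.2 y.2)) := by
      intro Y _ W
      rw [← Ent_equiv (Fin.consEquiv (fun _ => Y))]
      congr 1
      funext y
      unfold push
      rw [← Equiv.sum_comp (Fin.consEquiv (fun _ => X))]
      refine Finset.sum_congr rfl fun x _ => ?_
      simp [Wn, Fin.prod_univ_succ, Fin.consEquiv]
    rw [e W2, e W1]
    rw [Equiv.sum_comp (Fin.consEquiv (fun _ => X)) Q] at h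
    refine h.trans (le_of_eq ?_)
    push_cast; ring

theorem Ent_le_cross {A : Type} [Fintype A] (μ c : A → ℝ) (hμ : ∀ a, 0 ≤ μ a)
    (hc : ∀ a, 0 < c a) (hs : ∑ a, c a = 1) :
    Ent μ ≤ ∑ a, μ a * (-Real.log (c a)) := by
  set T := ∑ a, μ a with hT
  have hT0 : 0 ≤ T := Finset.sum_nonneg fun a _ => hμ a
  have leT : ∀ a, μ a ≤ T := fun a =>
    Finset.single_le_sum (f := μ) (fun a _ => hμ a) (Finset.mem_univ a)
  have key : ∀ a, μ a * Real.log T + μ a * Real.log (c a)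
      ≤ μ a * Real.log (μ a) + (T * c a - μ a) := by
    intro a
    rcases (hμ a).eq_or_lt with h0 | h0
    · rw [← h0]
      have := mul_nonneg hT0 (hc a).le
      simpa using this
    · have ht : 0 < T := h0.trans_le (leT a)
      have hq : 0 < T * c a := mul_pos ht (hc a)
      have := gibbs_pt h0.le hq.le (fun h => absurd h hq.ne')
      rw [Real.log_mul ht.ne' (hc a).ne'] at this
      linarith
  have sum := Finset.sum_le_sum (fun a (_ : a ∈ Finset.univ) => key a)
  simp only [Finset.sum_add_distrib, Finset.sum_sub_distrib, ← Finset.sum_mul,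
    ← Finset.mul_sum, hs] at sum
  unfold Ent Real.negMulLog
  simp only [neg_mul, Finset.sum_neg_distrib, mul_neg]
  rw [← hT] at sum ⊢
  linarith

theorem fano_pt {k : ℕ} (hk : 0 < k) (μ : Fin k → ℝ) (hμ : ∀ a, 0 ≤ μ a) (g : Fin k)
    (d : ℝ) (hd0 : 0 < d) (hd1 : d < 1) :
    Ent μ ≤ (∑ m, μ m) * (-Real.log (1 - d))
      + (∑ m, μ m * (if g = m then 0 else 1)) * (Real.log k - Real.log d) := by
  have hk' : (0:ℝ) < k := by exact_mod_cast hk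
  have hdk : 0 < d / k := by positivity
  have h := Ent_le_cross μ (fun m => (if g = m then (1 - d) else 0) + d / k) hμ
    (fun m => by split_ifs <;> linarith) (by
      rw [Finset.sum_add_distrib]; simp; field_simp; ring)
  refine h.trans ?_
  rw [Finset.sum_mul, Finset.sum_mul, ← Finset.sum_add_distrib]
  refine Finset.sum_le_sum fun m _ => ?_
  rw [mul_assoc, ← mul_add]
  refine mul_le_mul_of_nonneg_left ?_ (hμ m)
  split_ifs
  · have := Real.log_le_log (by linarith : 0 < 1 - d) (by linarith : 1 - d ≤ 1 - d + d / k)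
    linarith
  · have : Real.log (1 - d) ≤ 0 := Real.log_nonpos (by linarith) (by linarith)
    rw [zero_add, Real.log_div hd0.ne' hk'.ne']
    linarith

theorem fano_chain {Y : Type} [Fintype Y] {k : ℕ} (hk : 0 < k) (V : Fin k → Y → ℝ)
    (hV : IsChannel V) (g : Y → Fin k) (d : ℝ) (hd0 : 0 < d) (hd1 : d < 1) :
    Real.log k ≤ Ent (fun y => ∑ m, (1 / (k:ℝ)) * V m y) - (1 / (k:ℝ)) * ∑ m, Ent (V m)
      - Real.log (1 - d)
      + (1 / (k:ℝ)) * (∑ m, ∑ y, V m y * (if g y = m then 0 else 1))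
        * (Real.log k - Real.log d) := by
  have hk' : (0:ℝ) < k := by exact_mod_cast hk
  set P : Fin k → Y → ℝ := fun m y => (1 / (k:ℝ)) * V m y with hP
  have c1 := Ent_chain P
  have c2 := Ent_chain' P
  have e1 : Ent (fun m => ∑ y, P m y) = Real.log k := by
    have : (fun m => ∑ y, P m y) = fun m => 1 / (k:ℝ) := by
      funext m
      simp only [hP]
      rw [← Finset.mul_sum, (hV m).2, mul_one]
    rw [this]
    unfold Ent Real.negMulLog
    simp
    field_simp
    simp
  have e2 : ∑ m, Ent (fun y => P m y) = (1 / (k:ℝ)) * ∑ m, Ent (V m) := by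
    rw [Finset.mul_sum]
    exact Finset.sum_congr rfl fun m _ => Ent_smul _ _
  have h3 : ∑ y, Ent (fun m => P m y) ≤ ∑ y, ((∑ m, P m y) * (-Real.log (1 - d))
      + (∑ m, P m y * (if g y = m then 0 else 1)) * (Real.log k - Real.log d)) :=
    Finset.sum_le_sum fun y _ => fano_pt hk _
      (fun m => mul_nonneg (by positivity) ((hV m).1 y)) (g y) d hd0 hd1
  rw [Finset.sum_add_distrib, ← Finset.sum_mul, ← Finset.sum_mul] at h3
  have e4 : ∑ y, ∑ m, P m y = 1 := by
    rw [Finset.sum_comm]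
    simp only [hP, ← Finset.mul_sum, (hV _).2]
    simp; field_simp
  have e5 : ∑ y, ∑ m, P m y * (if g y = m then 0 else 1)
      = (1 / (k:ℝ)) * (∑ m, ∑ y, V m y * (if g y = m then 0 else 1)) := by
    rw [Finset.sum_comm, Finset.mul_sum]
    refine Finset.sum_congr rfl fun m _ => ?_
    rw [Finset.mul_sum]
    exact Finset.sum_congr rfl fun y _ => by simp only [hP]; ring
  rw [e4, e5] at h3
  rw [e1, e2] at c2
  linarith

section marg
variable {X Y1 Y2 : Type} [Fintype Y1] [Fintype Y2]

theorem marg1_nFold (W : X → Y1 × Y2 → ℝ) (n : ℕ) (x : Fin n → X) (y1 : Fin n → Y1) :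
    ∑ y2, nFold W n x (y1, y2) = Wn (margW1 W) n x y1 := by
  unfold nFold Wn margW1
  have := Finset.prod_univ_sum (fun _ : Fin n => (Finset.univ : Finset Y2))
    (fun t y => W (x t) (y1 t, y))
  rw [Fintype.piFinset_univ] at this
  rw [this]

theorem marg2_nFold (W : X → Y1 × Y2 → ℝ) (n : ℕ) (x : Fin n → X) (y2 : Fin n → Y2) :
    ∑ y1, nFold W n x (y1, y2) = Wn (margW2 W) n x y2 := by
  unfold nFold Wn margW2
  have := Finset.prod_univ_sum (fun _ : Fin n => (Finset.univ : Finset Y1))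
    (fun t y => W (x t) (y, y2 t))
  rw [Fintype.piFinset_univ] at this
  rw [this]

theorem nFold_nonneg (W : X → Y1 × Y2 → ℝ) (hW : IsChannel W) (n : ℕ) (x : Fin n → X) (y) :
    0 ≤ nFold W n x y := Finset.prod_nonneg fun t _ => (hW _).1 _

theorem marg1_ev (W : X → Y1 × Y2 → ℝ) (n : ℕ) (x : Fin n → X) (F : (Fin n → Y1) → ℝ) :
    ∑ y, nFold W n x y * F y.1 = ∑ y1, Wn (margW1 W) n x y1 * F y1 := by
  rw [Fintype.sum_prod_type]
  refine Finset.sum_congr rfl fun y1 _ => ?_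
  simp only
  rw [← Finset.sum_mul, marg1_nFold]

theorem marg2_ev (W : X → Y1 × Y2 → ℝ) (n : ℕ) (x : Fin n → X) (F : (Fin n → Y2) → ℝ) :
    ∑ y, nFold W n x y * F y.2 = ∑ y1, Wn (margW2 W) n x y1 * F y1 := by
  rw [Fintype.sum_prod_type_right]
  refine Finset.sum_congr rfl fun y1 _ => ?_
  simp only
  rw [← Finset.sum_mul, marg2_nFold]

theorem margW1_channel {W : X → Y1 × Y2 → ℝ} (hW : IsChannel W) : IsChannel (margW1 W) :=
  fun x => ⟨fun y => Finset.sum_nonneg fun y2 _ => (hW x).1 _, by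
    have := (hW x).2; rw [Fintype.sum_prod_type] at this; exact this⟩

theorem margW2_channel {W : X → Y1 × Y2 → ℝ} (hW : IsChannel W) : IsChannel (margW2 W) :=
  fun x => ⟨fun y => Finset.sum_nonneg fun y2 _ => (hW x).1 _, by
    have := (hW x).2; rw [Fintype.sum_prod_type_right] at this; exact this⟩
end marg

section conv
variable {X Y1 Y2 : Type} [Fintype X] [Fintype Y1] [Fintype Y2]

/-- conditional input distribution -/
def Qm {n k1 k2 : ℕ} (f : Fin k1 × Fin k2 → Fin n → X) (m1 : Fin k1) : (Fin n → X) → ℝ :=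
  fun x => ∑ m2, (1 / (k2:ℝ)) * (if f (m1, m2) = x then 1 else 0)

theorem Qm_nonneg {n k1 k2 : ℕ} (f : Fin k1 × Fin k2 → Fin n → X) (m1 : Fin k1) (x) :
    0 ≤ Qm f m1 x := Finset.sum_nonneg fun m2 _ => by positivity

theorem Qm_sum {n k1 k2 : ℕ} (h2 : 0 < k2) (f : Fin k1 × Fin k2 → Fin n → X) (m1 : Fin k1) :
    ∑ x, Qm f m1 x = 1 := by
  have : (0:ℝ) < k2 := by exact_mod_cast h2
  unfold Qm
  rw [Finset.sum_comm]
  simp only [← Finset.mul_sum]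
  simp
  field_simp

theorem Qm_push {n k1 k2 : ℕ} {Y : Type} (f : Fin k1 × Fin k2 → Fin n → X) (m1 : Fin k1)
    (V : (Fin n → X) → Y → ℝ) (y : Y) :
    push (Qm f m1) V y = ∑ m2, (1 / (k2:ℝ)) * V (f (m1, m2)) y := by
  unfold push Qm
  simp only [Finset.sum_mul]
  rw [Finset.sum_comm]
  refine Finset.sum_congr rfl fun m2 _ => ?_
  simp only [mul_assoc, ← Finset.mul_sum]
  simp

/-- Master converse inequality for one code. -/
theorem conv_code (W : X → Y1 × Y2 → ℝ) (hW : IsChannel W) (l C H1 h2 : ℝ) (hl : 1 ≤ l)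
    (hC : ∀ μ : X → ℝ, (∀ a, 0 ≤ μ a) →
      Ent (push μ (margW2 W)) - l * Ent (push μ (margW1 W)) ≤ C * ∑ a, μ a)
    (hH1 : ∀ μ : X → ℝ, (∀ a, 0 ≤ μ a) → Ent (push μ (margW1 W)) ≤ H1 * ∑ a, μ a)
    (hh2 : ∀ μ : X → ℝ, (∀ a, 0 ≤ μ a) → h2 * ∑ a, μ a ≤ Ent (push μ (margW2 W)))
    (n k1 k2 : ℕ) (hk1 : 0 < k1) (hk2 : 0 < k2)
    (f : Fin k1 × Fin k2 → Fin n → X) (g1 : (Fin n → Y1) → Fin k1)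
    (g2 : (Fin n → Y2) × Fin k1 → Fin k2) (d : ℝ) (hd0 : 0 < d) (hd1 : d < 1)
    (herr : errP2 W n k1 k2 f g1 g2 ≤ d) :
    Real.log k2 + l * Real.log k1 ≤ n * (C + l * H1 - h2)
      + (1 + l) * (-Real.log (1 - d)) + d * (Real.log k2 - Real.log d)
      + l * (d * (Real.log k1 - Real.log d)) := by
  have hk1' : (0:ℝ) < k1 := by exact_mod_cast hk1
  have hk2' : (0:ℝ) < k2 := by exact_mod_cast hk2
  have cW1 := Wn_channel (margW1_channel hW) n
  have cW2 := Wn_channel (margW2_channel hW) n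
  have ctriv : IsChannel (fun (_ : X) (_ : Unit) => (1:ℝ)) := fun x => ⟨fun _ => by norm_num, by simp⟩
  -- receiver 1
  have V1c : IsChannel (fun m1 => push (Qm f m1) (Wn (margW1 W) n)) := fun m1 =>
    ⟨fun y => Finset.sum_nonneg fun x _ => mul_nonneg (Qm_nonneg f m1 x) ((cW1 x).1 y), by
      rw [push_sum _ _ (fun x => (cW1 x).2), Qm_sum hk2]⟩
  have F1 := fano_chain hk1 _ V1c g1 d hd0 hd1
  -- receiver 2
  have F2 : ∀ m1, _ := fun m1 => fano_chain hk2 (fun m2 => Wn (margW2 W) n (f (m1, m2)))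
    (fun m2 => cW2 _) (fun y => g2 (y, m1)) d hd0 hd1
  have pe1 : (1 / (k1:ℝ)) * (∑ m, ∑ y, push (Qm f m) (Wn (margW1 W) n) y
      * (if g1 y = m then 0 else 1)) ≤ d := by
    refine le_trans (le_of_eq (b := (1 / ((k1:ℝ) * k2)) * ∑ m : Fin k1 × Fin k2,
        ∑ y : (Fin n → Y1) × (Fin n → Y2),
        nFold W n (f m) y * (if g1 y.1 = m.1 then 0 else 1)) ?_) (le_trans ?_ herr)
    · rw [Fintype.sum_prod_type, one_div_mul_eq_div, one_div_mul_eq_div, ← div_div,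
        div_right_comm]
      congr 1
      rw [Finset.sum_div]
      refine Finset.sum_congr rfl fun m1 _ => ?_
      simp only [Qm_push, marg1_ev W n _ (fun y => if g1 y = m1 then (0:ℝ) else 1), Finset.sum_mul]
      rw [Finset.sum_comm, Finset.sum_div]
      refine Finset.sum_congr rfl fun m2 _ => ?_
      rw [Finset.sum_div]
      exact Finset.sum_congr rfl fun y _ => by ring
    · unfold errP2
      refine mul_le_mul_of_nonneg_left ?_ (by positivity)
      refine Finset.sum_le_sum fun m _ => Finset.sum_le_sum fun y _ => ?_
      refine mul_le_mul_of_nonneg_left ?_ (nFold_nonneg W hW n _ _)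
      by_cases h : g1 y.1 = m.1 <;> simp [h]
      split_ifs <;> norm_num
  have pe2 : (1 / (k1:ℝ)) * ∑ m1, ((1 / (k2:ℝ)) * (∑ m2, ∑ y, Wn (margW2 W) n (f (m1, m2)) y
      * (if g2 (y, m1) = m2 then 0 else 1))) ≤ d := by
    refine le_trans (le_of_eq (b := (1 / ((k1:ℝ) * k2)) * ∑ m : Fin k1 × Fin k2,
        ∑ y : (Fin n → Y1) × (Fin n → Y2),
        nFold W n (f m) y * (if g2 (y.2, m.1) = m.2 then 0 else 1)) ?_) (le_trans ?_ herr)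
    · rw [Fintype.sum_prod_type, ← Finset.mul_sum, ← mul_assoc]
      congr 1
      · field_simp
      refine Finset.sum_congr rfl fun m1 _ => Finset.sum_congr rfl fun m2 _ => ?_
      exact (marg2_ev W n _ (fun y => if g2 (y, m1) = m2 then (0:ℝ) else 1)).symm
    · unfold errP2
      refine mul_le_mul_of_nonneg_left ?_ (by positivity)
      refine Finset.sum_le_sum fun m _ => Finset.sum_le_sum fun y _ => ?_
      refine mul_le_mul_of_nonneg_left ?_ (nFold_nonneg W hW n _ _)
      by_cases h : g2 (y.2, m.1) = m.2 <;> simp [h]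
      split_ifs <;> norm_num
  -- entropy bounds
  have B1 : Ent (fun y => ∑ m, (1 / (k1:ℝ)) * push (Qm f m) (Wn (margW1 W) n) y) ≤ n * H1 := by
    have := tensor_n (fun (_ : X) (_ : Unit) => (1:ℝ)) (margW1 W) ctriv (margW1_channel hW)
      1 H1 le_rfl (fun μ hμ => by
        rw [Ent_unique (push μ (fun (_ : X) (_ : Unit) => (1:ℝ)))]; simpa using hH1 μ hμ) n
      (fun x => ∑ m, (1 / (k1:ℝ)) * Qm f m x)
      (fun x => Finset.sum_nonneg fun m _ => mul_nonneg (by positivity) (Qm_nonneg f m x))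
    rw [Ent_unique (push _ (Wn (fun (_ : X) (_ : Unit) => (1:ℝ)) n)), Finset.sum_comm] at this
    simp only [← Finset.mul_sum, Qm_sum hk2] at this
    have e : ∀ y, (∑ m, (1 / (k1:ℝ)) * push (Qm f m) (Wn (margW1 W) n) y)
        = push (fun x => ∑ m, (1 / (k1:ℝ)) * Qm f m x) (Wn (margW1 W) n) y := by
      intro y
      simp only [push, Finset.sum_mul, Finset.mul_sum]
      rw [Finset.sum_comm]
      exact Finset.sum_congr rfl fun y _ => Finset.sum_congr rfl fun y _ => by ring
    simp only [e]
    simp only [← Finset.mul_sum] at this ⊢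
    have e3 : (1 / (k1:ℝ)) * ∑ i : Fin k1, (1:ℝ) = 1 := by simp; field_simp
    rw [e3] at this
    linarith
  have B2 : ∀ m1 m2, n * h2 ≤ Ent (Wn (margW2 W) n (f (m1, m2))) := by
    intro m1 m2
    have := tensor_n (margW2 W) (fun (_ : X) (_ : Unit) => (1:ℝ)) (margW2_channel hW) ctriv
      1 (-h2) le_rfl (fun μ hμ => by
        rw [Ent_unique (push μ (fun (_ : X) (_ : Unit) => (1:ℝ)))]; linarith [hh2 μ hμ]) n
      (fun x => if f (m1, m2) = x then 1 else 0) (fun x => by positivity)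
    rw [Ent_unique (push _ (Wn (fun (_ : X) (_ : Unit) => (1:ℝ)) n))] at this
    have e : push (fun x => if f (m1, m2) = x then 1 else 0) (Wn (margW2 W) n)
      = Wn (margW2 W) n (f (m1, m2)) := by
      funext y; simp [push]
    rw [e] at this
    simp at this
    linarith
  have B3 : ∀ m1, Ent (push (Qm f m1) (Wn (margW2 W) n))
      - l * Ent (push (Qm f m1) (Wn (margW1 W) n)) ≤ n * C := by
    intro m1
    have := tensor_n (margW1 W) (margW2 W) (margW1_channel hW) (margW2_channel hW) l C hl hC n
      (Qm f m1) (Qm_nonneg f m1)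
    rwa [Qm_sum hk2, mul_one] at this
  -- average F2
  have lk1 : 0 ≤ Real.log k1 - Real.log d := by
    have := Real.log_nonneg (by exact_mod_cast hk1 : (1:ℝ) ≤ k1)
    have := Real.log_nonpos hd0.le hd1.le
    linarith
  have lk2 : 0 ≤ Real.log k2 - Real.log d := by
    have := Real.log_nonneg (by exact_mod_cast hk2 : (1:ℝ) ≤ k2)
    have := Real.log_nonpos hd0.le hd1.le
    linarith
  have F2' : ∀ m1, Real.log k2 ≤ (n * C + l * Ent (push (Qm f m1) (Wn (margW1 W) n)))
      - n * h2 - Real.log (1 - d) + ((1 / (k2:ℝ)) * (∑ m2, ∑ y, Wn (margW2 W) n (f (m1, m2)) y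
      * (if g2 (y, m1) = m2 then 0 else 1))) * (Real.log k2 - Real.log d) := by
    intro m1
    have a := F2 m1
    have b := B3 m1
    have e : (fun y => ∑ m, (1 / (k2:ℝ)) * Wn (margW2 W) n (f (m1, m)) y)
      = push (Qm f m1) (Wn (margW2 W) n) := by funext y; rw [Qm_push]
    rw [e] at a
    have c : n * h2 ≤ (1 / (k2:ℝ)) * ∑ m2, Ent (Wn (margW2 W) n (f (m1, m2))) := by
      have := Finset.sum_le_sum (fun m2 (_ : m2 ∈ Finset.univ) => B2 m1 m2)
      simp only [Finset.sum_const, Finset.card_univ, Fintype.card_fin, nsmul_eq_mul] at this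
      rw [one_div_mul_eq_div, le_div_iff₀ hk2']
      linarith
    linarith
  have S := Finset.sum_le_sum (fun m1 (_ : m1 ∈ Finset.univ) => F2' m1)
  simp only [Finset.sum_add_distrib, Finset.sum_sub_distrib, Finset.sum_const, Finset.card_univ,
    Fintype.card_fin, nsmul_eq_mul, ← Finset.sum_mul] at S
  rw [← Finset.mul_sum] at S
  set E1 := ∑ m, Ent (push (Qm f m) (Wn (margW1 W) n)) with hE1
  set p2 := ∑ m1, ((1 / (k2:ℝ)) * (∑ m2, ∑ y, Wn (margW2 W) n (f (m1, m2)) y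
      * (if g2 (y, m1) = m2 then 0 else 1))) with hp2
  have S' : Real.log k2 ≤ n * C + l * ((1 / (k1:ℝ)) * E1) - n * h2 - Real.log (1 - d)
      + (1 / (k1:ℝ)) * p2 * (Real.log k2 - Real.log d) := by
    have := mul_le_mul_of_nonneg_left S (by positivity : 0 ≤ 1 / (k1:ℝ))
    field_simp at this ⊢
    linarith
  have m1 := mul_le_mul_of_nonneg_right pe1 lk1
  have m2 := mul_le_mul_of_nonneg_right pe2 lk2
  have F1' : Real.log k1 ≤ n * H1 - (1 / (k1:ℝ)) * E1 - Real.log (1 - d)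
      + d * (Real.log k1 - Real.log d) := by linarith
  have := mul_le_mul_of_nonneg_left F1' (by linarith : 0 ≤ l)
  linarith

/-- Converse inequality for receiver 2 alone. -/
theorem conv_code2 (W : X → Y1 × Y2 → ℝ) (hW : IsChannel W) (C h2 : ℝ)
    (hC : ∀ μ : X → ℝ, (∀ a, 0 ≤ μ a) → Ent (push μ (margW2 W)) ≤ C * ∑ a, μ a)
    (hh2 : ∀ μ : X → ℝ, (∀ a, 0 ≤ μ a) → h2 * ∑ a, μ a ≤ Ent (push μ (margW2 W)))
    (n k1 k2 : ℕ) (hk1 : 0 < k1) (hk2 : 0 < k2)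
    (f : Fin k1 × Fin k2 → Fin n → X) (g1 : (Fin n → Y1) → Fin k1)
    (g2 : (Fin n → Y2) × Fin k1 → Fin k2) (d : ℝ) (hd0 : 0 < d) (hd1 : d < 1)
    (herr : errP2 W n k1 k2 f g1 g2 ≤ d) :
    Real.log k2 ≤ n * (C - h2)
      + (-Real.log (1 - d)) + d * (Real.log k2 - Real.log d) := by
  have hk1' : (0:ℝ) < k1 := by exact_mod_cast hk1
  have hk2' : (0:ℝ) < k2 := by exact_mod_cast hk2
  have cW2 := Wn_channel (margW2_channel hW) n
  have ctriv : IsChannel (fun (_ : X) (_ : Unit) => (1:ℝ)) := fun x => ⟨fun _ => by norm_num, by simp⟩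
  have F2 : ∀ m1, _ := fun m1 => fano_chain hk2 (fun m2 => Wn (margW2 W) n (f (m1, m2)))
    (fun m2 => cW2 _) (fun y => g2 (y, m1)) d hd0 hd1
  have pe2 : (1 / (k1:ℝ)) * ∑ m1, ((1 / (k2:ℝ)) * (∑ m2, ∑ y, Wn (margW2 W) n (f (m1, m2)) y
      * (if g2 (y, m1) = m2 then 0 else 1))) ≤ d := by
    refine le_trans (le_of_eq (b := (1 / ((k1:ℝ) * k2)) * ∑ m : Fin k1 × Fin k2,
        ∑ y : (Fin n → Y1) × (Fin n → Y2),
        nFold W n (f m) y * (if g2 (y.2, m.1) = m.2 then 0 else 1)) ?_) (le_trans ?_ herr)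
    · rw [Fintype.sum_prod_type, ← Finset.mul_sum, ← mul_assoc]
      congr 1
      · field_simp
      refine Finset.sum_congr rfl fun m1 _ => Finset.sum_congr rfl fun m2 _ => ?_
      exact (marg2_ev W n _ (fun y => if g2 (y, m1) = m2 then (0:ℝ) else 1)).symm
    · unfold errP2
      refine mul_le_mul_of_nonneg_left ?_ (by positivity)
      refine Finset.sum_le_sum fun m _ => Finset.sum_le_sum fun y _ => ?_
      refine mul_le_mul_of_nonneg_left ?_ (nFold_nonneg W hW n _ _)
      by_cases h : g2 (y.2, m.1) = m.2 <;> simp [h]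
      split_ifs <;> norm_num
  have B2 : ∀ m1 m2, n * h2 ≤ Ent (Wn (margW2 W) n (f (m1, m2))) := by
    intro m1 m2
    have := tensor_n (margW2 W) (fun (_ : X) (_ : Unit) => (1:ℝ)) (margW2_channel hW) ctriv
      1 (-h2) le_rfl (fun μ hμ => by
        rw [Ent_unique (push μ (fun (_ : X) (_ : Unit) => (1:ℝ)))]; linarith [hh2 μ hμ]) n
      (fun x => if f (m1, m2) = x then 1 else 0) (fun x => by positivity)
    rw [Ent_unique (push _ (Wn (fun (_ : X) (_ : Unit) => (1:ℝ)) n))] at this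
    have e : push (fun x => if f (m1, m2) = x then 1 else 0) (Wn (margW2 W) n)
      = Wn (margW2 W) n (f (m1, m2)) := by
      funext y; simp [push]
    rw [e] at this
    simp at this
    linarith
  have B3 : ∀ m1, Ent (push (Qm f m1) (Wn (margW2 W) n)) ≤ n * C := by
    intro m1
    have := tensor_n (fun (_ : X) (_ : Unit) => (1:ℝ)) (margW2 W) ctriv (margW2_channel hW)
      1 C le_rfl (fun μ hμ => by
        rw [Ent_unique (push μ (fun (_ : X) (_ : Unit) => (1:ℝ)))]; simpa using hC μ hμ) n
      (Qm f m1) (Qm_nonneg f m1)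
    rw [Ent_unique (push _ (Wn (fun (_ : X) (_ : Unit) => (1:ℝ)) n)), Qm_sum hk2] at this
    linarith
  have lk2 : 0 ≤ Real.log k2 - Real.log d := by
    have := Real.log_nonneg (by exact_mod_cast hk2 : (1:ℝ) ≤ k2)
    have := Real.log_nonpos hd0.le hd1.le
    linarith
  have F2' : ∀ m1, Real.log k2 ≤ n * C
      - n * h2 - Real.log (1 - d) + ((1 / (k2:ℝ)) * (∑ m2, ∑ y, Wn (margW2 W) n (f (m1, m2)) y
      * (if g2 (y, m1) = m2 then 0 else 1))) * (Real.log k2 - Real.log d) := by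
    intro m1
    have a := F2 m1
    have b := B3 m1
    have e : (fun y => ∑ m, (1 / (k2:ℝ)) * Wn (margW2 W) n (f (m1, m)) y)
      = push (Qm f m1) (Wn (margW2 W) n) := by funext y; rw [Qm_push]
    rw [e] at a
    have c : n * h2 ≤ (1 / (k2:ℝ)) * ∑ m2, Ent (Wn (margW2 W) n (f (m1, m2))) := by
      have := Finset.sum_le_sum (fun m2 (_ : m2 ∈ Finset.univ) => B2 m1 m2)
      simp only [Finset.sum_const, Finset.card_univ, Fintype.card_fin, nsmul_eq_mul] at this
      rw [one_div_mul_eq_div, le_div_iff₀ hk2']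
      linarith
    linarith
  have S := Finset.sum_le_sum (fun m1 (_ : m1 ∈ Finset.univ) => F2' m1)
  simp only [Finset.sum_add_distrib, Finset.sum_const, Finset.card_univ,
    Fintype.card_fin, nsmul_eq_mul, ← Finset.sum_mul] at S
  set p2 := ∑ m1, ((1 / (k2:ℝ)) * (∑ m2, ∑ y, Wn (margW2 W) n (f (m1, m2)) y
      * (if g2 (y, m1) = m2 then 0 else 1))) with hp2
  have S' : Real.log k2 ≤ n * C - n * h2 - Real.log (1 - d)
      + (1 / (k1:ℝ)) * p2 * (Real.log k2 - Real.log d) := by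
    have := mul_le_mul_of_nonneg_left S (by positivity : 0 ≤ 1 / (k1:ℝ))
    field_simp at this ⊢
    linarith
  have m2 := mul_le_mul_of_nonneg_right pe2 lk2
  linarith
end conv

theorem Hb_log (x : ℝ) : Hb x * Real.log 2 = Real.binEntropy x := by
  have h2 : Real.log 2 ≠ 0 := (Real.log_pos (by norm_num)).ne'
  unfold Hb Real.logb
  rw [Real.binEntropy_eq_negMulLog_add_negMulLog_one_sub]
  unfold Real.negMulLog
  field_simp
  ring

theorem Hb_eq (x : ℝ) : Hb x = Real.binEntropy x / Real.log 2 := by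
  have h2 : Real.log 2 ≠ 0 := (Real.log_pos (by norm_num)).ne'
  rw [← Hb_log]; field_simp

theorem BSC_channel {p : ℝ} (hp0 : 0 ≤ p) (hp : p ≤ 1) : IsChannel (BSCk p) := by
  intro x
  refine ⟨fun y => ?_, ?_⟩
  · unfold BSCk; split_ifs <;> linarith
  · cases x <;> simp [BSCk]

theorem BEC_channel {e : ℝ} (he0 : 0 ≤ e) (he : e ≤ 1) : IsChannel (BECk e) := by
  intro x
  refine ⟨fun y => ?_, ?_⟩
  · unfold BECk
    cases y
    · exact he0
    · simp only; split_ifs <;> linarith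
  · cases x <;> simp [BECk, Fintype.sum_option]

theorem bool_param (μ : Bool → ℝ) (hμ : ∀ a, 0 ≤ μ a) :
    ∃ a ∈ Set.Icc (0:ℝ) 1, μ = fun b => (∑ c, μ c) * (if b then a else 1 - a) := by
  by_cases h : ∑ c, μ c = 0
  · refine ⟨0, by simp, ?_⟩
    rw [h]
    have := (Finset.sum_eq_zero_iff_of_nonneg (fun a _ => hμ a)).1 h
    funext b
    simpa using this b (Finset.mem_univ b)
  · have h0 : 0 < ∑ c, μ c := lt_of_le_of_ne (Finset.sum_nonneg fun a _ => hμ a) (Ne.symm h)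
    refine ⟨μ true / ∑ c, μ c, ⟨div_nonneg (hμ _) h0.le, ?_⟩, ?_⟩
    · rw [div_le_one h0]; simp; exact hμ false
    · have e : ∑ c, μ c = μ true + μ false := by simp
      funext b
      cases b
      · simp only [Bool.false_eq_true, if_false]; field_simp; rw [e]; ring
      · simp only [if_true]; field_simp

theorem Ent_BSC (a p : ℝ) :
    Ent (push (fun b : Bool => if b then a else 1 - a) (BSCk p)) = Real.binEntropy (bconv a p) := by
  rw [Real.binEntropy_eq_negMulLog_add_negMulLog_one_sub]
  have e1 : push (fun b : Bool => if b then a else 1 - a) (BSCk p) true = bconv a p := by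
    simp [push, BSCk, bconv]
  have e2 : push (fun b : Bool => if b then a else 1 - a) (BSCk p) false = 1 - bconv a p := by
    simp [push, BSCk, bconv]; ring
  unfold Ent
  simp [e1, e2]

theorem Ent_BEC (a e : ℝ) :
    Ent (push (fun b : Bool => if b then a else 1 - a) (BECk e))
      = Real.binEntropy e + (1 - e) * Real.binEntropy a := by
  rw [Real.binEntropy_eq_negMulLog_add_negMulLog_one_sub,
    Real.binEntropy_eq_negMulLog_add_negMulLog_one_sub]
  have e1 : push (fun b : Bool => if b then a else 1 - a) (BECk e) none = e := by
    simp [push, BECk]; ring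
  have e2 : push (fun b : Bool => if b then a else 1 - a) (BECk e) (some true) = (1 - e) * a := by
    simp [push, BECk]; ring
  have e3 : push (fun b : Bool => if b then a else 1 - a) (BECk e) (some false)
      = (1 - e) * (1 - a) := by
    simp [push, BECk]; ring
  unfold Ent
  simp only [Fintype.sum_option, Fintype.sum_bool, e1, e2, e3]
  rw [show e + ((1 - e) * a + (1 - e) * (1 - a)) = 1 by ring, Real.negMulLog_mul,
    Real.negMulLog_mul, Real.negMulLog_one]
  ring

theorem push_smul {Y : Type} (c : ℝ) (μ : Bool → ℝ) (W : Bool → Y → ℝ) :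
    push (fun b => c * μ b) W = fun y => c * push μ W y := by
  funext y; simp [push]; ring

theorem bconv_mem {a p : ℝ} (ha0 : 0 ≤ a) (ha : a ≤ 1) (hp0 : 0 ≤ p) (hp : p ≤ 1) :
    0 ≤ bconv a p ∧ bconv a p ≤ 1 := by
  unfold bconv
  constructor
  · have := mul_nonneg ha0 (sub_nonneg.2 hp); have := mul_nonneg (sub_nonneg.2 ha) hp0; linarith
  · nlinarith [mul_nonneg ha0 hp0, mul_nonneg (sub_nonneg.2 ha) (sub_nonneg.2 hp)]

/-- small terms vanish -/
theorem small_tendsto (A B D : ℝ) (h : ∀ d : ℝ, 0 < d → d < 1 →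
    (1 - d) * A ≤ B + D * (-Real.log (1 - d) - d * Real.log d)) : A ≤ B := by
  have c : ContinuousAt
      (fun d : ℝ => B + D * (-Real.log (1 - d) - d * Real.log d) - (1 - d) * A) 0 := by
    have h1 : ContinuousAt (fun d : ℝ => Real.log (1 - d)) 0 :=
      ContinuousAt.log (by fun_prop) (by norm_num)
    have h2 : ContinuousAt (fun d : ℝ => d * Real.log d) 0 := Real.continuous_mul_log.continuousAt
    fun_prop
  have t := (c.tendsto).mono_left (nhdsWithin_le_nhds (s := Set.Ioi 0))
  have : ∀ᶠ d in nhdsWithin (0:ℝ) (Set.Ioi 0),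
      0 ≤ B + D * (-Real.log (1 - d) - d * Real.log d) - (1 - d) * A := by
    filter_upwards [Ioo_mem_nhdsGT (show (0:ℝ) < 1 by norm_num)] with d hd
    linarith [h d hd.1 hd.2]
  have := ge_of_tendsto t this
  simp at this
  exact this

theorem conv_sum {p e : ℝ} (hp0 : 0 ≤ p) (hp : p ≤ 1) (he0 : 0 ≤ e) (he : e ≤ 1)
    (W : Bool → Bool × Option Bool → ℝ) (hW : IsChannel W)
    (hm1 : ∀ x y, margW1 W x y = BSCk p x y)
    (hm2 : ∀ x y, margW2 W x y = BECk e x y)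
    (R : ℝ × ℝ) (hR : Ach2 W R) (l c : ℝ) (hl : 1 ≤ l)
    (hc : ∀ a ∈ Set.Icc (0:ℝ) 1, (1 - e) * Hb a - l * Hb (bconv a p) ≤ c) :
    R.2 + l * R.1 ≤ l + c := by
  have h2 : 0 < Real.log 2 := Real.log_pos (by norm_num)
  have m1 : margW1 W = BSCk p := by funext x y; exact hm1 x y
  have m2 : margW2 W = BECk e := by funext x y; exact hm2 x y
  refine le_of_mul_le_mul_right ?_ h2
  refine small_tendsto _ _ (1 + l) fun d hd0 hd1 => ?_
  obtain ⟨n, k1, k2, hn, hk1, hk2, f, g1, g2, hr1, hr2, herr⟩ := hR.2.2 d hd0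
  have key := conv_code W hW l (Real.binEntropy e + c * Real.log 2) (Real.log 2)
    (Real.binEntropy e) hl
    (fun μ hμ => by
      obtain ⟨a, ha, h⟩ := bool_param μ hμ
      have hT : 0 ≤ ∑ c, μ c := Finset.sum_nonneg fun a _ => hμ a
      set T := ∑ c, μ c
      rw [h, m1, m2, push_smul, push_smul, Ent_smul, Ent_smul, Ent_BSC, Ent_BEC,
        ← Hb_log a, ← Hb_log (bconv a p)]
      have := mul_le_mul_of_nonneg_left (mul_le_mul_of_nonneg_right (hc a ha) h2.le) hT
      nlinarith)
    (fun μ hμ => by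
      obtain ⟨a, ha, h⟩ := bool_param μ hμ
      have hT : 0 ≤ ∑ c, μ c := Finset.sum_nonneg fun a _ => hμ a
      set T := ∑ c, μ c
      rw [h, m1, push_smul, Ent_smul, Ent_BSC, mul_comm]
      exact mul_le_mul_of_nonneg_right Real.binEntropy_le_log_two hT)
    (fun μ hμ => by
      obtain ⟨a, ha, h⟩ := bool_param μ hμ
      have hT : 0 ≤ ∑ c, μ c := Finset.sum_nonneg fun a _ => hμ a
      set T := ∑ c, μ c
      rw [h, m2, push_smul, Ent_smul, Ent_BEC, mul_comm]
      refine mul_le_mul_of_nonneg_left ?_ hT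
      have := mul_nonneg (sub_nonneg.2 he) (Real.binEntropy_nonneg ha.1 ha.2)
      linarith)
    n k1 k2 hk1 hk2 f g1 g2 d hd0 hd1 herr
  have hn' : (1:ℝ) ≤ n := by exact_mod_cast hn
  have hn0 : (0:ℝ) < n := by linarith
  rw [le_div_iff₀ hn0, Real.logb, le_div_iff₀ h2] at hr1 hr2
  have t1 : 0 ≤ -Real.log (1 - d) - d * Real.log d := by
    have := Real.log_nonpos (by linarith : 0 ≤ 1 - d) (by linarith)
    have := mul_nonneg hd0.le (neg_nonneg.2 (Real.log_nonpos hd0.le hd1.le))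
    linarith
  set τ := -Real.log (1 - d) - d * Real.log d
  have k : (1 - d) * (R.2 * n * Real.log 2 + l * (R.1 * n * Real.log 2))
      ≤ n * ((l + c) * Real.log 2) + (1 + l) * τ := by
    have := mul_le_mul_of_nonneg_left hr1 (by linarith : 0 ≤ l)
    have := mul_le_mul_of_nonneg_left (add_le_add hr2 this) (by linarith : 0 ≤ 1 - d)
    refine this.trans ?_
    simp only [τ]
    linarith
  have k2' : (1 + l) * τ ≤ n * ((1 + l) * τ) := by
    have : 0 ≤ (1 + l) * τ := by positivity
    nlinarith
  refine le_of_mul_le_mul_left ?_ hn0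
  linarith

theorem conv_R2 {p e : ℝ} (hp0 : 0 ≤ p) (hp : p ≤ 1) (he0 : 0 ≤ e) (he : e ≤ 1)
    (W : Bool → Bool × Option Bool → ℝ) (hW : IsChannel W)
    (hm1 : ∀ x y, margW1 W x y = BSCk p x y)
    (hm2 : ∀ x y, margW2 W x y = BECk e x y)
    (R : ℝ × ℝ) (hR : Ach2 W R) : R.2 ≤ 1 - e := by
  have h2 : 0 < Real.log 2 := Real.log_pos (by norm_num)
  have m2 : margW2 W = BECk e := by funext x y; exact hm2 x y
  refine le_of_mul_le_mul_right ?_ h2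
  refine small_tendsto _ _ 1 fun d hd0 hd1 => ?_
  obtain ⟨n, k1, k2, hn, hk1, hk2, f, g1, g2, hr1, hr2, herr⟩ := hR.2.2 d hd0
  have key := conv_code2 W hW (Real.binEntropy e + (1 - e) * Real.log 2)
    (Real.binEntropy e)
    (fun μ hμ => by
      obtain ⟨a, ha, h⟩ := bool_param μ hμ
      have hT : 0 ≤ ∑ c, μ c := Finset.sum_nonneg fun a _ => hμ a
      set T := ∑ c, μ c
      rw [h, m2, push_smul, Ent_smul, Ent_BEC, mul_comm]
      refine mul_le_mul_of_nonneg_right ?_ hT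
      have := mul_le_mul_of_nonneg_left (Real.binEntropy_le_log_two (p := a)) (sub_nonneg.2 he)
      linarith)
    (fun μ hμ => by
      obtain ⟨a, ha, h⟩ := bool_param μ hμ
      have hT : 0 ≤ ∑ c, μ c := Finset.sum_nonneg fun a _ => hμ a
      set T := ∑ c, μ c
      rw [h, m2, push_smul, Ent_smul, Ent_BEC, mul_comm]
      refine mul_le_mul_of_nonneg_left ?_ hT
      have := mul_nonneg (sub_nonneg.2 he) (Real.binEntropy_nonneg ha.1 ha.2)
      linarith)
    n k1 k2 hk1 hk2 f g1 g2 d hd0 hd1 herr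
  have hn' : (1:ℝ) ≤ n := by exact_mod_cast hn
  have hn0 : (0:ℝ) < n := by linarith
  rw [le_div_iff₀ hn0, Real.logb, le_div_iff₀ h2] at hr2
  have t1 : 0 ≤ -Real.log (1 - d) - d * Real.log d := by
    have := Real.log_nonpos (by linarith : 0 ≤ 1 - d) (by linarith)
    have := mul_nonneg hd0.le (neg_nonneg.2 (Real.log_nonpos hd0.le hd1.le))
    linarith
  set τ := -Real.log (1 - d) - d * Real.log d
  have k : (1 - d) * (R.2 * n * Real.log 2)
      ≤ n * ((1 - e) * Real.log 2) + 1 * τ := by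
    have := mul_le_mul_of_nonneg_left hr2 (by linarith : 0 ≤ 1 - d)
    refine this.trans ?_
    simp only [τ]
    linarith
  have k2' : 1 * τ ≤ n * (1 * τ) := by
    nlinarith
  refine le_of_mul_le_mul_left ?_ hn0
  linarith

/-- The outer bound, closed form. -/
theorem outer {p e : ℝ} (hp0 : 0 ≤ p) (hp : p ≤ 1) (he0 : 0 ≤ e) (he : e ≤ 1)
    (W : Bool → Bool × Option Bool → ℝ) (hW : IsChannel W)
    (hm1 : ∀ x y, margW1 W x y = BSCk p x y)
    (hm2 : ∀ x y, margW2 W x y = BECk e x y)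
    (R : ℝ × ℝ) (hR : R ∈ Cap2 W) : 0 ≤ R.1 ∧ 0 ≤ R.2 ∧ R.2 ≤ 1 - e ∧
    ∀ l c : ℝ, 1 ≤ l → (∀ a ∈ Set.Icc (0:ℝ) 1, (1 - e) * Hb a - l * Hb (bconv a p) ≤ c) →
      R.2 + l * R.1 ≤ l + c := by
  have cl : ∀ (φ : ℝ × ℝ → ℝ) (b : ℝ), Continuous φ → (∀ R, Ach2 W R → φ R ≤ b) → φ R ≤ b := by
    intro φ b hφ h
    have : closure {R | Ach2 W R} ⊆ {R | φ R ≤ b} :=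
      closure_minimal h (isClosed_le hφ continuous_const)
    exact this hR
  refine ⟨?_, ?_, ?_, ?_⟩
  · have := cl (fun R => -R.1) 0 (by fun_prop) (fun R h => by linarith [h.1])
    simpa using this
  · have := cl (fun R => -R.2) 0 (by fun_prop) (fun R h => by linarith [h.2.1])
    simpa using this
  · exact cl (fun R => R.2) _ (by fun_prop) (conv_R2 hp0 hp he0 he W hW hm1 hm2)
  · intro l c hl hc
    exact cl (fun R => R.2 + l * R.1) _ (by fun_prop)
      (fun R h => conv_sum hp0 hp he0 he W hW hm1 hm2 R h l c hl hc)

/-- twice artanh -/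
def At (u : ℝ) : ℝ := Real.log (1 + u) - Real.log (1 - u)

theorem At_deriv {u : ℝ} (h0 : -1 < u) (h1 : u < 1) : HasDerivAt At (2 / (1 - u ^ 2)) u := by
  have a : HasDerivAt (fun u : ℝ => Real.log (1 + u)) (1 / (1 + u)) u :=
    ((hasDerivAt_id u).const_add 1).log (by simp; linarith)
  have b : HasDerivAt (fun u : ℝ => Real.log (1 - u)) (-1 / (1 - u)) u :=
    ((hasDerivAt_id u).const_sub 1).log (by simp; linarith)
  refine (a.sub b).congr_deriv ?_
  have : 1 + u ≠ 0 := by linarith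
  have : 1 - u ≠ 0 := by linarith
  have : 1 - u ^ 2 ≠ 0 := by
    rw [show 1 - u ^ 2 = (1 + u) * (1 - u) by ring]; positivity
  field_simp
  ring

theorem At_zero : At 0 = 0 := by simp [At]

theorem one_sub_sq_pos {u : ℝ} (h0 : -1 < u) (h1 : u < 1) : 0 < 1 - u ^ 2 := by nlinarith

theorem At_lower {u : ℝ} (h0 : 0 < u) (h1 : u < 1) : 2 * u < At u := by
  have m : StrictMonoOn (fun u => At u - 2 * u) (Set.Ico 0 1) := by
    refine strictMonoOn_of_hasDerivWithinAt_pos (f' := fun u => 2 / (1 - u ^ 2) - 2 * 1) (convex_Ico 0 1) ?_ ?_ ?_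
    · intro x hx
      have := (At_deriv (by linarith [hx.1]) hx.2).continuousAt
      exact ContinuousAt.continuousWithinAt (by fun_prop)
    · intro x hx
      rw [interior_Ico] at hx
      exact ((At_deriv (by linarith [hx.1]) hx.2).sub ((hasDerivAt_id x).const_mul 2)).hasDerivWithinAt
    · intro x hx
      rw [interior_Ico] at hx
      have := one_sub_sq_pos (by linarith [hx.1]) hx.2
      have h : 2 < 2 / (1 - x ^ 2) := by
        rw [lt_div_iff₀ this]; nlinarith [pow_pos hx.1 2]
      linarith
  have := m (by simp : (0:ℝ) ∈ Set.Ico 0 1) (⟨h0.le, h1⟩ : u ∈ Set.Ico 0 1) h0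
  simp only [At_zero] at this
  linarith

theorem At_pos {u : ℝ} (h0 : 0 < u) (h1 : u < 1) : 0 < At u := by
  linarith [At_lower h0 h1]

theorem At_upper {u : ℝ} (h0 : 0 < u) (h1 : u < 1) : At u ≤ u * (2 - u) / (1 - u) := by
  have a := Real.log_le_sub_one_of_pos (by linarith : 0 < 1 + u)
  have b := Real.one_sub_inv_le_log_of_pos (by linarith : 0 < 1 - u)
  unfold At
  have : u * (2 - u) / (1 - u) = (1 + u - 1) - (1 - (1 - u)⁻¹) := by
    have : 1 - u ≠ 0 := by linarith
    field_simp; ring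
  linarith

theorem At_scale {k u : ℝ} (hk0 : 0 ≤ k) (hk1 : k ≤ 1) (h0 : 0 ≤ u) (h1 : u < 1) :
    At (k * u) ≤ k * At u := by
  have lt : ∀ x, x ∈ Set.Ico (0:ℝ) 1 → -1 < k * x ∧ k * x < 1 := fun x hx =>
    ⟨by nlinarith [mul_nonneg hk0 hx.1], by nlinarith [hx.1, hx.2]⟩
  have dd : ∀ x, x ∈ Set.Ico (0:ℝ) 1 → HasDerivAt (fun u => k * At u - At (k * u))
      (k * (2 / (1 - x ^ 2)) - (2 / (1 - (k * x) ^ 2)) * k) x := fun x hx =>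
    ((At_deriv (by linarith [hx.1]) hx.2).const_mul k).sub
      (HasDerivAt.comp x (At_deriv (lt x hx).1 (lt x hx).2)
        (by simpa using (hasDerivAt_id x).const_mul k))
  have m : MonotoneOn (fun u => k * At u - At (k * u)) (Set.Ico 0 1) := by
    refine monotoneOn_of_hasDerivWithinAt_nonneg (convex_Ico 0 1)
      (fun x hx => (dd x hx).continuousAt.continuousWithinAt)
      (fun x hx => (dd x (interior_subset hx)).hasDerivWithinAt) ?_
    intro x hx
    have hx := interior_subset hx
    have p1 := one_sub_sq_pos (by linarith [hx.1]) hx.2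
    have p2 := one_sub_sq_pos (lt x hx).1 (lt x hx).2
    have : 2 / (1 - (k * x) ^ 2) ≤ 2 / (1 - x ^ 2) := by
      apply div_le_div_of_nonneg_left (by norm_num) p1
      have : k ^ 2 ≤ 1 := by nlinarith
      nlinarith [sq_nonneg x]
    nlinarith
  have := m (by simp : (0:ℝ) ∈ Set.Ico 0 1) (⟨h0, h1⟩ : u ∈ Set.Ico 0 1) h0
  simp only [mul_zero, At_zero, sub_zero] at this
  linarith

theorem At_G_anti : StrictAntiOn (fun u => (1 - u ^ 2) * At u / u) (Set.Ioo 0 1) := by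
  have dd : ∀ x : ℝ, x ∈ Set.Ioo (0:ℝ) 1 → HasDerivAt (fun u => (1 - u ^ 2) * At u / u)
      ((((-(2 * x)) * At x + (1 - x ^ 2) * (2 / (1 - x ^ 2))) * x - (1 - x ^ 2) * At x * 1)
        / x ^ 2) x := by
    intro x hx
    have h1 : HasDerivAt (fun u : ℝ => 1 - u ^ 2) (-(2 * x)) x := by
      have := ((hasDerivAt_id x).pow 2).const_sub 1
      simpa using this
    exact (h1.mul (At_deriv (by linarith [hx.1]) hx.2)).div (hasDerivAt_id x) hx.1.ne'
  refine strictAntiOn_of_hasDerivWithinAt_neg (convex_Ioo 0 1)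
    (fun x hx => (dd x hx).continuousAt.continuousWithinAt)
    (fun x hx => (dd x (interior_subset hx)).hasDerivWithinAt) ?_
  intro x hx
  have hx := interior_subset hx
  have p1 := one_sub_sq_pos (by linarith [hx.1]) hx.2
  refine div_neg_of_neg_of_pos ?_ (pow_pos hx.1 2)
  rw [mul_div_cancel₀ _ p1.ne']
  have := At_lower hx.1 hx.2
  nlinarith [mul_pos (pow_pos hx.1 2) (At_pos hx.1 hx.2)]

theorem At_ratio_anti {k : ℝ} (hk0 : 0 < k) (hk1 : k < 1) :
    StrictAntiOn (fun u => At (k * u) / At u) (Set.Ioo 0 1) := by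
  have lt : ∀ x, x ∈ Set.Ioo (0:ℝ) 1 → 0 < k * x ∧ k * x < 1 := fun x hx =>
    ⟨mul_pos hk0 hx.1, by nlinarith [hx.1, hx.2]⟩
  have dd : ∀ x, x ∈ Set.Ioo (0:ℝ) 1 → HasDerivAt (fun u => At (k * u) / At u)
      (((2 / (1 - (k * x) ^ 2) * k) * At x - At (k * x) * (2 / (1 - x ^ 2))) / At x ^ 2) x :=
    fun x hx => HasDerivAt.div
      (HasDerivAt.comp x (At_deriv (by linarith [(lt x hx).1]) (lt x hx).2)
        (by simpa using (hasDerivAt_id x).const_mul k))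
      (At_deriv (by linarith [hx.1]) hx.2) (At_pos hx.1 hx.2).ne'
  refine strictAntiOn_of_hasDerivWithinAt_neg (convex_Ioo 0 1)
    (fun x hx => (dd x hx).continuousAt.continuousWithinAt)
    (fun x hx => (dd x (interior_subset hx)).hasDerivWithinAt) ?_
  intro x hx
  have hx := interior_subset hx
  have p1 := one_sub_sq_pos (by linarith [hx.1]) hx.2
  have p2 := one_sub_sq_pos (by linarith [(lt x hx).1]) (lt x hx).2
  refine div_neg_of_neg_of_pos ?_ (pow_pos (At_pos hx.1 hx.2) 2)
  have g := At_G_anti (lt x hx) hx (by nlinarith [hx.1])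
  simp only at g
  rw [div_lt_div_iff₀ hx.1 (lt x hx).1] at g
  have g' : (1 - x ^ 2) * At x * k < (1 - (k * x) ^ 2) * At (k * x) := by
    have := hx.1
    refine lt_of_mul_lt_mul_right ?_ this.le
    linarith
  rw [sub_neg, div_mul_eq_mul_div, div_mul_eq_mul_div, ← mul_div_assoc,
    div_lt_div_iff₀ p2 p1]
  linarith

theorem At_cross {k u v : ℝ} (hk0 : 0 < k) (hk1 : k ≤ 1) (hv : 0 < v) (huv : v ≤ u) (hu : u < 1) :
    At (k * u) * At v ≤ At (k * v) * At u := by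
  rcases hk1.eq_or_lt with rfl | hk1
  · simp only [one_mul]; linarith
  have := (At_ratio_anti hk0 hk1).antitoneOn (⟨hv, by linarith⟩ : v ∈ Set.Ioo 0 1)
    (⟨by linarith, hu⟩ : u ∈ Set.Ioo 0 1) huv
  rwa [div_le_div_iff₀ (At_pos (by linarith) hu) (At_pos hv (by linarith))] at this

/-- derivative of the binary entropy -/
def Lf (a : ℝ) : ℝ := Real.log (1 - a) - Real.log a

theorem Lf_eq {a : ℝ} (h0 : 0 < a) (h1 : a < 1) : Lf a = At (1 - 2 * a) := by
  unfold Lf At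
  rw [show 1 + (1 - 2 * a) = 2 * (1 - a) by ring, show 1 - (1 - 2 * a) = 2 * a by ring,
    Real.log_mul (by norm_num) (by linarith), Real.log_mul (by norm_num) (by linarith)]
  ring

theorem bconv_pos {a p : ℝ} (h0 : 0 < a) (h1 : a < 1) (hp0 : 0 ≤ p) (hp : p ≤ 1) :
    0 < bconv a p ∧ bconv a p < 1 := by
  unfold bconv
  constructor
  · rcases hp0.eq_or_lt with rfl | h
    · simpa using h0
    · nlinarith [mul_nonneg h0.le (sub_nonneg.2 hp), mul_pos (sub_pos.2 h1) h]
  · rcases hp0.eq_or_lt with rfl | h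
    · simpa using h1
    · nlinarith [mul_nonneg (sub_nonneg.2 h1.le) (sub_nonneg.2 hp), mul_pos h0 h]

theorem Lf_bconv {a p : ℝ} (h0 : 0 < a) (h1 : a < 1) (hp0 : 0 ≤ p) (hp : p ≤ 1) :
    Lf (bconv a p) = At ((1 - 2 * p) * (1 - 2 * a)) := by
  rw [Lf_eq (bconv_pos h0 h1 hp0 hp).1 (bconv_pos h0 h1 hp0 hp).2]
  congr 1
  unfold bconv; ring

theorem logb_eq {a : ℝ} (h0 : 0 < a) (h1 : a < 1) :
    Real.logb 2 ((1 - a) / a) = Lf a / Real.log 2 := by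
  unfold Real.logb Lf
  rw [Real.log_div (by linarith) (by linarith)]

theorem bconv_one_sub (a p : ℝ) : bconv (1 - a) p = 1 - bconv a p := by unfold bconv; ring

theorem bconv_cont (p : ℝ) : Continuous fun a => bconv a p := by unfold bconv; fun_prop

theorem bin_conv_deriv {a p : ℝ} (h0 : 0 < a) (h1 : a < 1) (hp0 : 0 ≤ p) (hp : p ≤ 1) :
    HasDerivAt (fun a => Real.binEntropy (bconv a p)) (Lf (bconv a p) * (1 - 2 * p)) a := by
  have b := bconv_pos h0 h1 hp0 hp
  have h := Real.hasDerivAt_binEntropy (p := bconv a p) (by linarith) (by linarith)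
  have h2 : HasDerivAt (fun a => bconv a p) (1 - 2 * p) a := by
    have := ((hasDerivAt_id a).mul_const (1 - 2 * p)).add_const p
    rw [one_mul] at this
    refine this.congr_of_eventuallyEq (Filter.Eventually.of_forall fun x => ?_)
    unfold bconv; simp; ring
  exact HasDerivAt.comp a h h2

/-- Optimality lemma. -/
theorem opt {p e α l : ℝ} (hp0 : 0 ≤ p) (hp : p < 1/2) (he : e ≤ 1) (h0 : 0 < α) (h1 : α < 1/2)
    (hl : l * ((1 - 2 * p) * Lf (bconv α p)) = (1 - e) * Lf α) :
    ∀ a ∈ Set.Icc (0:ℝ) 1, (1 - e) * Hb a - l * Hb (bconv a p)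
      ≤ (1 - e) * Hb α - l * Hb (bconv α p) := by
  have hk0 : 0 < 1 - 2 * p := by linarith
  have hk1 : 1 - 2 * p ≤ 1 := by linarith
  set g : ℝ → ℝ := fun a => (1 - e) * Real.binEntropy a - l * Real.binEntropy (bconv a p) with hg
  have gc : Continuous g := by
    have := Real.binEntropy_continuous.comp (bconv_cont p)
    have h2 := Real.binEntropy_continuous
    exact (continuous_const.mul h2).sub (continuous_const.mul this)
  have gd : ∀ a, 0 < a → a < 1 →
      HasDerivAt g ((1 - e) * Lf a - l * (Lf (bconv a p) * (1 - 2 * p))) a := fun a h0 h1 =>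
    ((Real.hasDerivAt_binEntropy (by linarith) (by linarith)).const_mul _).sub
      ((bin_conv_deriv h0 h1 hp0 (by linarith)).const_mul _)
  have hα : 0 < Lf (bconv α p) := by
    rw [Lf_bconv h0 (by linarith) hp0 (by linarith)]
    exact At_pos (by apply mul_pos <;> linarith) (by nlinarith)
  have dform : ∀ a, Lf (bconv α p) * ((1 - e) * Lf a - l * (Lf (bconv a p) * (1 - 2 * p)))
      = (1 - e) * (Lf (bconv α p) * Lf a - Lf (bconv a p) * Lf α) := by
    intro a
    linear_combination (-Lf (bconv a p)) * hl
  have mono : MonotoneOn g (Set.Icc 0 α) := by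
    refine monotoneOn_of_hasDerivWithinAt_nonneg (convex_Icc 0 α) gc.continuousOn
      (fun x hx => by
        rw [interior_Icc] at hx
        exact (gd x hx.1 (by linarith [hx.2])).hasDerivWithinAt) ?_
    intro x hx
    rw [interior_Icc] at hx
    refine nonneg_of_mul_nonneg_right (?_ : 0 ≤ Lf (bconv α p) * _) hα
    rw [dform]
    refine mul_nonneg (by linarith) ?_
    rw [Lf_bconv h0 (by linarith) hp0 (by linarith),
      Lf_bconv hx.1 (by linarith [hx.2]) hp0 (by linarith),
      Lf_eq h0 (by linarith), Lf_eq hx.1 (by linarith [hx.2])]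
    have := At_cross hk0 hk1 (by linarith : 0 < 1 - 2 * α) (by linarith [hx.2] : _ ≤ 1 - 2 * x)
      (by linarith [hx.1])
    linarith
  have anti : AntitoneOn g (Set.Icc α (1/2)) := by
    refine antitoneOn_of_hasDerivWithinAt_nonpos (convex_Icc α (1/2)) gc.continuousOn
      (fun x hx => by
        rw [interior_Icc] at hx
        exact (gd x (by linarith [hx.1]) (by linarith [hx.2])).hasDerivWithinAt) ?_
    intro x hx
    rw [interior_Icc] at hx
    refine nonpos_of_mul_nonpos_right (?_ : Lf (bconv α p) * _ ≤ 0) hα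
    rw [dform]
    refine mul_nonpos_of_nonneg_of_nonpos (by linarith) ?_
    rw [Lf_bconv h0 (by linarith) hp0 (by linarith),
      Lf_bconv (by linarith [hx.1]) (by linarith [hx.2]) hp0 (by linarith),
      Lf_eq h0 (by linarith), Lf_eq (by linarith [hx.1]) (by linarith [hx.2])]
    have := At_cross hk0 hk1 (by linarith [hx.2] : 0 < 1 - 2 * x) (by linarith [hx.1] : _ ≤ 1 - 2 * α)
      (by linarith)
    linarith
  have half : ∀ a ∈ Set.Icc (0:ℝ) (1/2), g a ≤ g α := by
    intro a ha
    rcases le_total a α with h | h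
    · exact mono ⟨ha.1, h⟩ ⟨h0.le, le_rfl⟩ h
    · exact anti ⟨le_rfl, h1.le⟩ ⟨h, ha.2⟩ h
  have full : ∀ a ∈ Set.Icc (0:ℝ) 1, g a ≤ g α := by
    intro a ha
    rcases le_total a (1/2) with h | h
    · exact half a ⟨ha.1, h⟩
    · have e : g a = g (1 - a) := by
        simp only [hg]
        rw [bconv_one_sub, Real.binEntropy_one_sub, Real.binEntropy_one_sub]
      rw [e]
      exact half _ ⟨by linarith [ha.2], by linarith⟩
  intro a ha
  have h2 : 0 < Real.log 2 := Real.log_pos (by norm_num)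
  refine le_of_mul_le_mul_right ?_ h2
  have := full a ha
  simp only [hg, ← Hb_log] at this
  linarith

/-- less-noisy slope inequality -/
theorem slope_ge {p e a : ℝ} (hp0 : 0 ≤ p) (hp : p ≤ 1/2) (hep : e ≤ 4 * p * (1 - p))
    (h0 : 0 < a) (h1 : a ≤ 1/2) :
    (1 - 2 * p) * Lf (bconv a p) ≤ (1 - e) * Lf a := by
  rw [Lf_bconv h0 (by linarith) hp0 (by linarith), Lf_eq h0 (by linarith)]
  have s := At_scale (by linarith : 0 ≤ 1 - 2 * p) (by linarith) (by linarith : 0 ≤ 1 - 2 * a)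
    (by linarith)
  have A0 : 0 ≤ At (1 - 2 * a) := by
    rcases (by linarith : 0 ≤ 1 - 2 * a).eq_or_lt with h | h
    · rw [← h, At_zero]
    · exact (At_pos h (by linarith)).le
  have := mul_le_mul_of_nonneg_left s (by linarith : 0 ≤ 1 - 2 * p)
  nlinarith

theorem Hb_half : Hb (1/2) = 1 := by
  rw [Hb_eq, show (1/2:ℝ) = 2⁻¹ by norm_num, Real.binEntropy_two_inv, div_self]
  exact (Real.log_pos (by norm_num)).ne'

theorem Hb_cont : Continuous Hb := by
  have : Hb = fun x => Real.binEntropy x / Real.log 2 := funext Hb_eq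
  rw [this]
  exact Real.binEntropy_continuous.div_const _

theorem Hb_le_one (x : ℝ) : Hb x ≤ 1 := by
  rw [Hb_eq, div_le_one (Real.log_pos (by norm_num))]
  exact Real.binEntropy_le_log_two

theorem Hb_nonneg {x : ℝ} (h0 : 0 ≤ x) (h1 : x ≤ 1) : 0 ≤ Hb x := by
  rw [Hb_eq]
  exact div_nonneg (Real.binEntropy_nonneg h0 h1) (Real.log_pos (by norm_num)).le

theorem Hb_zero : Hb 0 = 0 := by simp [Hb]

theorem Hb_mono {x y : ℝ} (h0 : 0 ≤ x) (hxy : x ≤ y) (h1 : y ≤ 1/2) : Hb x ≤ Hb y := by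
  rw [Hb_eq, Hb_eq]
  have : (1/2:ℝ) = 2⁻¹ := by norm_num
  have := Real.binEntropy_strictMonoOn.monotoneOn (a := x) (b := y) ⟨h0, by linarith⟩
    ⟨by linarith, by linarith⟩ hxy
  have h2 : 0 < Real.log 2 := Real.log_pos (by norm_num)
  gcongr

/-- in the less noisy case the sum rate is bounded by `1 - e` -/
theorem sum_le {p e a : ℝ} (hp0 : 0 ≤ p) (hp : p ≤ 1/2) (hep : e ≤ 4 * p * (1 - p))
    (h0 : 0 ≤ a) (h1 : a ≤ 1/2) :
    1 - Hb (bconv a p) + (1 - e) * Hb a ≤ 1 - e := by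
  set g : ℝ → ℝ := fun a => (1 - e) * Real.binEntropy a - Real.binEntropy (bconv a p) with hg
  have gc : Continuous g := by
    have := Real.binEntropy_continuous.comp (bconv_cont p)
    have h2 := Real.binEntropy_continuous
    exact (continuous_const.mul h2).sub this
  have mono : MonotoneOn g (Set.Icc 0 (1/2)) := by
    refine monotoneOn_of_hasDerivWithinAt_nonneg (convex_Icc 0 (1/2)) gc.continuousOn
      (fun x hx => by
        rw [interior_Icc] at hx
        exact (((Real.hasDerivAt_binEntropy (by linarith [hx.1])
          (by linarith [hx.2])).const_mul _).sub
            (bin_conv_deriv hx.1 (by linarith [hx.2]) hp0 (by linarith))).hasDerivWithinAt) ?_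
    intro x hx
    rw [interior_Icc] at hx
    have := slope_ge hp0 hp hep hx.1 hx.2.le
    unfold Lf at this
    unfold Lf
    linarith
  have h2 : 0 < Real.log 2 := Real.log_pos (by norm_num)
  have := mono ⟨h0, h1⟩ ⟨by norm_num, le_rfl⟩ h1
  simp only [hg, ← Hb_log] at this
  rw [show bconv (1/2) p = 1/2 by unfold bconv; ring, Hb_half] at this
  refine le_of_mul_le_mul_right ?_ h2
  linarith

/-- Existence and uniqueness of the crossing point. -/
theorem exists_root {p e : ℝ} (hp0 : 0 < p) (hp : p ≤ 1/2) (hep : 4 * p * (1 - p) < e)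
    (he : e < 1) :
    ∃! a : ℝ, a ∈ Set.Ioo (0:ℝ) (1/2) ∧ (1 - 2 * p) * Lf (bconv a p) = (1 - e) * Lf a := by
  have hp' : p < 1/2 := by
    rcases hp.eq_or_lt with rfl | h
    · norm_num at hep; linarith
    · exact h
  have hk0 : 0 < 1 - 2 * p := by linarith
  have hk1 : 1 - 2 * p < 1 := by linarith
  have hq : 1 - e < (1 - 2 * p) ^ 2 := by nlinarith
  set k := 1 - 2 * p with hk
  refine existsUnique_of_exists_of_unique ?_ ?_
  · -- existence in the variable u
    have he' : 0 < 1 - e := by linarith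
    obtain ⟨u1, hu10, hu11, hu1⟩ : ∃ u, 0 < u ∧ u < 1 ∧ (1 - e) * At u < k * At (k * u) := by
      refine ⟨(k ^ 2 - (1 - e)) / 2, by linarith, by nlinarith, ?_⟩
      set u := (k ^ 2 - (1 - e)) / 2 with hu
      have u0 : 0 < u := by linarith
      have u1 : u < 1/2 := by nlinarith
      have a1 := At_upper u0 (by linarith)
      have a2 := At_lower (u := k * u) (by positivity) (by nlinarith)
      have a3 : (1 - e) * (u * (2 - u) / (1 - u)) ≤ k * (2 * (k * u)) := by
        rw [← mul_div_assoc, div_le_iff₀ (by linarith)]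
        have : (1 - e) * (2 - u) ≤ 2 * k ^ 2 * (1 - u) := by
          have e1 : 1 - e = k ^ 2 - 2 * u := by rw [hu]; ring
          have e2 : k ^ 2 ≤ 1 := by nlinarith
          rw [e1]
          nlinarith [mul_nonneg u0.le (sub_nonneg.2 e2), mul_nonneg u0.le (sub_nonneg.2 u1.le)]
        nlinarith
      have := mul_le_mul_of_nonneg_left a1 he'.le
      have := mul_lt_mul_of_pos_left a2 hk0
      linarith
    obtain ⟨u2, hu20, hu21, hu22, hu2⟩ : ∃ u, 0 < u ∧ u < 1 ∧ u1 ≤ u ∧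
        k * At (k * u) < (1 - e) * At u := by
      have t : Filter.Tendsto (fun u : ℝ => k * At (k * u) - (1 - e) * At u)
          (nhdsWithin 1 (Set.Iio 1)) Filter.atBot := by
        have c1 : Filter.Tendsto (fun u : ℝ => k * At (k * u) - (1 - e) * Real.log (1 + u))
            (nhdsWithin 1 (Set.Iio 1)) (nhds (k * At (k * 1) - (1 - e) * Real.log (1 + 1))) := by
          have : ContinuousAt (fun u : ℝ => k * At (k * u) - (1 - e) * Real.log (1 + u)) 1 := by
            have d1 : ContinuousAt At (k * 1) := (At_deriv (by linarith) (by linarith)).continuousAt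
            have d2 : ContinuousAt (fun u : ℝ => At (k * u)) 1 :=
              ContinuousAt.comp (f := fun u : ℝ => k * u) d1 (by fun_prop)
            have d3 : ContinuousAt (fun u : ℝ => Real.log (1 + u)) 1 :=
              ContinuousAt.log (by fun_prop) (by norm_num)
            fun_prop
          exact this.tendsto.mono_left nhdsWithin_le_nhds
        have c2 : Filter.Tendsto (fun u : ℝ => (1 - e) * Real.log (1 - u))
            (nhdsWithin 1 (Set.Iio 1)) Filter.atBot := by
          refine Filter.Tendsto.const_mul_atBot he' ?_
          refine Real.tendsto_log_nhdsGT_zero.comp ?_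
          refine tendsto_nhdsWithin_of_tendsto_nhds_of_eventually_within _ ?_ ?_
          · have : ContinuousAt (fun u : ℝ => 1 - u) 1 := by fun_prop
            have := this.tendsto.mono_left (nhdsWithin_le_nhds (s := Set.Iio 1))
            simpa using this
          · filter_upwards [self_mem_nhdsWithin] with x hx
            simpa using hx
        have := c1.add_atBot c2
        refine this.congr fun u => ?_
        unfold At; ring
      have ev := t.eventually (Filter.eventually_lt_atBot 0)
      obtain ⟨u, h1, h2⟩ := (ev.and (Ioo_mem_nhdsLT hu11)).exists
      exact ⟨u, by linarith [h2.1], h2.2, h2.1.le, by linarith⟩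
    have cont : ContinuousOn (fun u : ℝ => k * At (k * u) - (1 - e) * At u) (Set.Icc u1 u2) := by
      intro x hx
      have d1 : ContinuousAt At (k * x) := (At_deriv (by nlinarith [hx.1]) (by nlinarith [hx.1, hx.2])).continuousAt
      have d2 : ContinuousAt (fun u : ℝ => At (k * u)) x :=
        ContinuousAt.comp (f := fun u : ℝ => k * u) d1 (by fun_prop)
      have d3 : ContinuousAt At x := (At_deriv (by linarith [hx.1]) (by linarith [hx.2])).continuousAt
      exact ContinuousAt.continuousWithinAt (by fun_prop)
    obtain ⟨u, hu, h⟩ := intermediate_value_Icc' hu22 cont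
      (⟨by linarith, by linarith⟩ : (0:ℝ) ∈ Set.Icc _ _)
    refine ⟨(1 - u) / 2, ⟨by linarith [hu.2], by linarith [hu.1]⟩, ?_⟩
    rw [Lf_bconv (by linarith [hu.2]) (by linarith [hu.1]) hp0.le (by linarith),
      Lf_eq (by linarith [hu.2]) (by linarith [hu.1]),
      show 1 - 2 * ((1 - u) / 2) = u by ring]
    linarith
  · rintro a b ⟨ha, ea⟩ ⟨hb, eb⟩
    have hf : ∀ a : ℝ, a ∈ Set.Ioo (0:ℝ) (1/2) → k * Lf (bconv a p) = (1 - e) * Lf a →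
        At (k * (1 - 2 * a)) / At (1 - 2 * a) = (1 - e) / k := by
      intro a ha h
      rw [Lf_bconv ha.1 (by linarith [ha.2]) hp0.le (by linarith),
        Lf_eq ha.1 (by linarith [ha.2])] at h
      have := At_pos (u := 1 - 2 * a) (by linarith [ha.2]) (by linarith [ha.1])
      rw [div_eq_div_iff this.ne' hk0.ne']
      linarith
    have := (At_ratio_anti hk0 hk1).injOn
      (⟨by linarith [ha.2], by linarith [ha.1]⟩ : 1 - 2 * a ∈ Set.Ioo 0 1)
      (⟨by linarith [hb.2], by linarith [hb.1]⟩ : 1 - 2 * b ∈ Set.Ioo 0 1)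
      (by rw [hf a ha ea, hf b hb eb])
    linarith

/-- product weight -/
def PW {ι Λ : Type} [Fintype ι] (μ : Λ → ℝ) (u : ι → Λ) : ℝ := ∏ i, μ (u i)

theorem sum_prod_fun {ι Λ : Type} [Fintype ι] [DecidableEq ι] [Fintype Λ] (g : ι → Λ → ℝ) :
    ∑ w : ι → Λ, ∏ i, g i (w i) = ∏ i, ∑ a, g i a := by
  rw [Finset.prod_univ_sum, Fintype.piFinset_univ]

theorem PW_nonneg {ι Λ : Type} [Fintype ι] [DecidableEq ι] {μ : Λ → ℝ} (h : ∀ a, 0 ≤ μ a) (u : ι → Λ) :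
    0 ≤ PW μ u := Finset.prod_nonneg fun i _ => h _

theorem PW_pmf {ι Λ : Type} [Fintype ι] [DecidableEq ι] [Fintype Λ] {μ : Λ → ℝ} (h : IsPMF μ) :
    IsPMF (PW (ι := ι) μ) := by
  refine ⟨PW_nonneg h.1, ?_⟩
  unfold PW
  rw [sum_prod_fun (fun _ : ι => μ)]
  simp [h.2]

theorem PW_split {ι Λ : Type} [Fintype ι] [DecidableEq ι] [Fintype Λ] (μ : Λ → ℝ) (c : ι)
    (F : Λ → ({j // j ≠ c} → Λ) → ℝ) :
    ∑ u : ι → Λ, PW μ u * F (u c) (fun j => u j) = ∑ a, ∑ r, μ a * PW μ r * F a r := by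
  rw [← Fintype.sum_prod_type']
  refine Fintype.sum_equiv (Equiv.funSplitAt c Λ) _ _ fun u => ?_
  simp only [Equiv.funSplitAt_apply]
  congr 1
  unfold PW
  rw [← Finset.mul_prod_erase univ _ (mem_univ c)]
  congr 1
  refine Finset.prod_subtype _ (fun x => ?_) (fun x => μ (u x))
  simp

theorem PW_m1 {ι Λ : Type} [Fintype ι] [DecidableEq ι] [Fintype Λ] {μ : Λ → ℝ} (h : IsPMF μ) (c : ι)
    (F : Λ → ℝ) : ∑ u : ι → Λ, PW μ u * F (u c) = ∑ a, μ a * F a := by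
  rw [PW_split μ c (fun a _ => F a)]
  refine Finset.sum_congr rfl fun a _ => ?_
  have := (PW_pmf (ι := {j // j ≠ c}) h).2
  rw [← Finset.sum_mul, ← Finset.mul_sum, this, mul_one]

theorem PW_m2 {ι Λ : Type} [Fintype ι] [DecidableEq ι] [Fintype Λ] {μ : Λ → ℝ} (h : IsPMF μ) {c c' : ι}
    (hc : c' ≠ c) (F : Λ → Λ → ℝ) :
    ∑ u : ι → Λ, PW μ u * F (u c) (u c') = ∑ a, μ a * ∑ b, μ b * F a b := by
  rw [PW_split μ c (fun a r => F a (r ⟨c', hc⟩))]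
  refine Finset.sum_congr rfl fun a _ => ?_
  rw [← PW_m1 h (⟨c', hc⟩ : {j // j ≠ c}) (F a), Finset.mul_sum]
  exact Finset.sum_congr rfl fun r _ => by ring

theorem PW_pair {ι Λ Γ : Type} [Fintype ι] [DecidableEq ι] [Fintype Λ] [Fintype Γ] (μ : Λ → ℝ) (ν : Γ → ℝ)
    (G : (ι → Λ) → (ι → Γ) → ℝ) :
    ∑ b, PW μ b * ∑ z, PW ν z * G b z =
      ∑ w : ι → Λ × Γ, PW (fun l => μ l.1 * ν l.2) w * G (fun i => (w i).1) (fun i => (w i).2) := by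
  simp_rw [Finset.mul_sum]
  rw [← Fintype.sum_prod_type']
  refine (Fintype.sum_equiv (Equiv.arrowProdEquivProdArrow ι (fun _ => Λ) (fun _ => Γ)) _ _ fun w => ?_).symm
  simp only [PW, Finset.prod_mul_distrib, Equiv.arrowProdEquivProdArrow]
  exact mul_assoc _ _ _

theorem pmf_prod {Λ Γ : Type} [Fintype Λ] [Fintype Γ] {μ : Λ → ℝ} {ν : Γ → ℝ}
    (h : IsPMF μ) (h' : IsPMF ν) : IsPMF (fun l : Λ × Γ => μ l.1 * ν l.2) := by
  refine ⟨fun l => mul_nonneg (h.1 _) (h'.1 _), ?_⟩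
  rw [Fintype.sum_prod_type]
  simp_rw [← Finset.mul_sum, h'.2, mul_one, h.2]

/-- Chernoff bound -/
theorem chern {Λ : Type} [Fintype Λ] {P h : Λ → ℝ} (hP : IsPMF P) (hh : ∀ l, P l ≠ 0 → 0 < h l)
    (hneg : ∑ l, P l * Real.log (h l) < 0) :
    ∃ r : ℝ, 0 ≤ r ∧ r < 1 ∧ ∀ (n : ℕ) (ev : (Fin n → Λ) → Prop),
      (∀ w, (∀ i, P (w i) ≠ 0) → ev w → 1 ≤ ∏ i, h (w i)) →
      ∑ w, PW P w * (if ev w then 1 else 0) ≤ r ^ n := by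
  set φ : ℝ → ℝ := fun t => ∑ l, P l * Real.exp (t * Real.log (h l)) with hφ
  have hd : HasDerivAt φ (∑ l, P l * Real.log (h l)) 0 := by
    have : HasDerivAt φ (∑ l, P l * (Real.exp (0 * Real.log (h l)) * (1 * Real.log (h l)))) 0 := by
      refine HasDerivAt.fun_sum fun l _ => ?_
      exact (((hasDerivAt_id (0:ℝ)).mul_const (Real.log (h l))).exp).const_mul (P l)
    simpa using this
  have h0 : φ 0 = 1 := by simp [hφ, hP.2]
  obtain ⟨t, ht0, ht⟩ : ∃ t, 0 < t ∧ φ t < 1 := by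
    have := hd.hasDerivWithinAt (s := Set.Ioi 0)
    rw [hasDerivWithinAt_iff_tendsto_slope' (by simp)] at this
    have ev := this.eventually (gt_mem_nhds hneg)
    obtain ⟨t, h1, h2⟩ := (ev.and self_mem_nhdsWithin).exists
    refine ⟨t, h2, ?_⟩
    have h2 : 0 < t := h2
    rw [slope_def_field, sub_zero, h0, div_lt_iff₀ h2] at h1
    linarith
  refine ⟨φ t, Finset.sum_nonneg fun l _ => mul_nonneg (hP.1 l) (Real.exp_pos _).le, ht, ?_⟩
  intro n ev hev
  have : φ t ^ n = ∑ w : Fin n → Λ, ∏ i, (P (w i) * Real.exp (t * Real.log (h (w i)))) := by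
    rw [sum_prod_fun (fun (_ : Fin n) l => P l * Real.exp (t * Real.log (h l)))]
    simp [hφ]
  rw [this]
  refine Finset.sum_le_sum fun w _ => ?_
  rw [Finset.prod_mul_distrib]
  by_cases hw : ∀ i, P (w i) ≠ 0
  · refine mul_le_mul_of_nonneg_left ?_ (PW_nonneg hP.1 w)
    split_ifs with he
    · have h1 := hev w hw he
      have h2 : 0 ≤ Real.log (∏ i, h (w i)) := Real.log_nonneg h1
      rw [Real.log_prod (fun i _ => (hh _ (hw i)).ne')] at h2
      rw [← Real.exp_sum, ← Finset.mul_sum]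
      exact Real.one_le_exp (mul_nonneg ht0.le h2)
    · exact Finset.prod_nonneg fun i _ => (Real.exp_pos _).le
  · push Not at hw
    obtain ⟨i, hi⟩ := hw
    have : PW P w = 0 := Finset.prod_eq_zero (mem_univ i) hi
    have h' : ∏ i, P (w i) = 0 := this
    rw [this, h']; simp

theorem Wn_noise {X Y Z : Type} [Fintype Y] [DecidableEq Y] [Fintype Z] (W : X → Y → ℝ) (N : Z → ℝ)
    (app : X → Z → Y) (h : ∀ x y, W x y = ∑ z, N z * (if app x z = y then 1 else 0)) (n : ℕ)
    (x : Fin n → X) (G : (Fin n → Y) → ℝ) :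
    ∑ y, Wn W n x y * G y = ∑ z : Fin n → Z, PW N z * G (fun t => app (x t) (z t)) := by
  have e : ∀ y, Wn W n x y = ∑ z : Fin n → Z, PW N z *
      (if (fun t => app (x t) (z t)) = y then 1 else 0) := by
    intro y
    unfold Wn
    simp_rw [h]
    rw [← sum_prod_fun (fun t z => N z * (if app (x t) z = y t then (1:ℝ) else 0))]
    refine Finset.sum_congr rfl fun z _ => ?_
    rw [Finset.prod_mul_distrib]
    congr 1
    rw [Finset.prod_ite_zero]
    simp [funext_iff]
  simp_rw [e, Finset.sum_mul]
  rw [Finset.sum_comm]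
  refine Finset.sum_congr rfl fun z _ => ?_
  simp

/-- Bernoulli pmf -/
def bern (a : ℝ) : Bool → ℝ := fun b => if b then a else 1 - a

theorem bern_pmf {a : ℝ} (h0 : 0 ≤ a) (h1 : a ≤ 1) : IsPMF (bern a) := by
  refine ⟨fun b => ?_, by simp [bern]⟩
  unfold bern; split_ifs <;> linarith

theorem BSC_noise (p : ℝ) (x y : Bool) :
    BSCk p x y = ∑ z, bern p z * (if (x ^^ z) = y then 1 else 0) := by
  cases x <;> cases y <;> simp [BSCk, bern]

/-- erasure map: flag true means not erased -/
def eapp (x z : Bool) : Option Bool := if z then some x else none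

theorem BEC_noise (e : ℝ) (x : Bool) (y : Option Bool) :
    BECk e x y = ∑ z, bern (1 - e) z * (if eapp x z = y then 1 else 0) := by
  cases x <;> rcases y with _ | _ | _ <;> simp [BECk, bern, eapp]

/-- expectation -/
def Ex {Λ : Type} [Fintype Λ] (μ F : Λ → ℝ) : ℝ := ∑ a, μ a * F a

section ExL
variable {Λ Γ : Type} [Fintype Λ] [Fintype Γ]

theorem Ex_add (μ F G : Λ → ℝ) : Ex μ (fun a => F a + G a) = Ex μ F + Ex μ G := by
  simp [Ex, mul_add, Finset.sum_add_distrib]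

theorem Ex_smul (μ F : Λ → ℝ) (k : ℝ) : Ex μ (fun a => k * F a) = k * Ex μ F := by
  simp only [Ex, Finset.mul_sum]
  exact Finset.sum_congr rfl fun a _ => by ring

theorem Ex_sum {I : Type} (s : Finset I) (μ : Λ → ℝ) (F : I → Λ → ℝ) :
    Ex μ (fun a => ∑ i ∈ s, F i a) = ∑ i ∈ s, Ex μ (F i) := by
  simp only [Ex, Finset.mul_sum]
  exact Finset.sum_comm

theorem Ex_const {μ : Λ → ℝ} (h : IsPMF μ) (k : ℝ) : Ex μ (fun _ => k) = k := by
  rw [Ex, ← Finset.sum_mul, h.2, one_mul]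

theorem Ex_mono {μ : Λ → ℝ} (h : IsPMF μ) {F G : Λ → ℝ} (hFG : ∀ a, F a ≤ G a) :
    Ex μ F ≤ Ex μ G :=
  Finset.sum_le_sum fun a _ => mul_le_mul_of_nonneg_left (hFG a) (h.1 a)

theorem Ex_le {μ : Λ → ℝ} (h : IsPMF μ) {F : Λ → ℝ} {k : ℝ} (hF : ∀ a, F a ≤ k) :
    Ex μ F ≤ k := (Ex_mono h hF).trans (Ex_const h k).le

theorem Ex_comm (μ : Λ → ℝ) (ν : Γ → ℝ) (F : Λ → Γ → ℝ) :
    Ex μ (fun a => Ex ν (F a)) = Ex ν (fun b => Ex μ (fun a => F a b)) := by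
  simp only [Ex, Finset.mul_sum]
  rw [Finset.sum_comm]
  exact Finset.sum_congr rfl fun a _ => Finset.sum_congr rfl fun b _ => by ring

theorem Ex_exists {μ : Λ → ℝ} (h : IsPMF μ) {F : Λ → ℝ} {k : ℝ} (hF : Ex μ F ≤ k) :
    ∃ a, F a ≤ k := by
  by_contra hc
  push Not at hc
  have : ∃ a, 0 < μ a := by
    by_contra h'
    push Not at h'
    have : ∑ a, μ a ≤ 0 := Finset.sum_nonpos fun a _ => h' a
    rw [h.2] at this; linarith
  obtain ⟨a, ha⟩ := this
  have : Ex μ (fun _ => k) < Ex μ F :=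
    Finset.sum_lt_sum (fun a _ => mul_le_mul_of_nonneg_left (hc a).le (h.1 a))
      ⟨a, mem_univ a, mul_lt_mul_of_pos_left (hc a) ha⟩
  rw [Ex_const h] at this
  linarith

end ExL

/-- pointwise xor -/
def xr {n : ℕ} (a b : Fin n → Bool) : Fin n → Bool := fun i => (a i ^^ b i)

theorem half_pmf : IsPMF (fun _ : Bool => (1/2 : ℝ)) := by
  refine ⟨fun _ => by norm_num, by norm_num⟩

/-- indicator -/
def ind (P : Prop) : ℝ := if P then 1 else 0

theorem ind_nonneg (P : Prop) : 0 ≤ ind P := by unfold ind; split_ifs <;> norm_num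
theorem ind_le (P : Prop) : ind P ≤ 1 := by unfold ind; split_ifs <;> norm_num

section core
variable {n : ℕ} {C S : Type} [Fintype C] [DecidableEq C] [Fintype S] [DecidableEq S]

/-- error bound, receiver 1 -/
def e1 (p : ℝ) (T : (Fin n → Bool) → Prop) (u : C → Fin n → Bool) (v : S → Fin n → Bool)
    (c : C) (s : S) : ℝ :=
  Ex (PW (bern p)) fun z => ind (¬ T (xr (v s) z)) +
    ∑ c' ∈ univ.erase c, ind (T (xr (xr (xr (u c) (v s)) z) (u c')))

/-- weight of the unerased letters -/
def hS (g : Bool → ℝ) (b z : Fin n → Bool) : ℝ := ∏ i, if z i then g (b i) else 1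

/-- error bound, receiver 2 -/
def e2 {K : Type} (e : ℝ) (σ : C → K) (B1 : (Fin n → Bool) → (Fin n → Bool) → Prop)
    (B2 : (Fin n → Bool) → Prop) (u : C → Fin n → Bool) (v : S → Fin n → Bool)
    (c : C) (s : S) : ℝ :=
  Ex (PW (bern (1 - e))) fun z => ind (B1 (v s) z) + ind (B2 z) +
    (∑ s' ∈ univ.erase s, ind (¬ B1 (v s) z) * ind (∀ i, z i = true → v s' i = v s i)) +
    ∑ c' ∈ univ.filter (fun c' => σ c' = σ c ∧ c' ≠ c), ∑ s', ind (¬ B2 z) *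
      ind (∀ i, z i = true → xr (u c') (v s') i = xr (u c) (v s) i)

theorem exp1 {α p : ℝ} (hα0 : 0 ≤ α) (hα1 : α ≤ 1) (hp0 : 0 ≤ p) (hp1 : p ≤ 1)
    (T : (Fin n → Bool) → Prop) {ρ τ : ℝ}
    (hρ : Ex (PW (bern α)) (fun b => Ex (PW (bern p)) fun z => ind (¬ T (xr b z))) ≤ ρ)
    (hτ : ∑ w, (1/2:ℝ) ^ n * ind (T w) ≤ τ) (c : C) (s : S) :
    Ex (PW (PW (fun _ => 1/2))) (fun u : C → Fin n → Bool =>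
      Ex (PW (PW (bern α))) fun v : S → Fin n → Bool => e1 p T u v c s)
      ≤ ρ + (Fintype.card C - 1 : ℝ) * τ := by
  have hU : IsPMF (PW (ι := Fin n) (fun _ : Bool => (1/2 : ℝ))) := PW_pmf half_pmf
  have hV : IsPMF (PW (ι := Fin n) (bern α)) := PW_pmf (bern_pmf hα0 hα1)
  have hZ : IsPMF (PW (ι := Fin n) (bern p)) := PW_pmf (bern_pmf hp0 hp1)
  unfold e1
  simp only [Ex_add, Ex_sum]
  refine add_le_add ?_ ?_
  · rw [Ex_const (PW_pmf hU)]
    exact (PW_m1 hV s (fun b => Ex (PW (bern p)) fun z => ind (¬ T (xr b z)))).trans_le hρ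
  · have : ∀ c' ∈ univ.erase c, Ex (PW (PW (fun _ => 1/2))) (fun u : C → Fin n → Bool =>
      Ex (PW (PW (bern α))) fun v : S → Fin n → Bool =>
        Ex (PW (bern p)) fun z => ind (T (xr (xr (xr (u c) (v s)) z) (u c')))) ≤ τ := by
      intro c' hc'
      rw [Ex_comm]
      refine Ex_le (PW_pmf hV) fun v => ?_
      rw [Ex_comm]
      refine Ex_le hZ fun z => ?_
      refine (PW_m2 hU (Finset.ne_of_mem_erase hc') (fun a b => ind (T (xr (xr (xr a (v s)) z) b)))).trans_le ?_
      refine Ex_le hU fun a => ?_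
      refine le_trans (le_of_eq ?_) hτ
      have inv : Function.Involutive (fun b => xr (xr (xr a (v s)) z) b) := by
        intro b; funext i; simp only [xr]
        cases b i <;> cases a i <;> cases v s i <;> cases z i <;> rfl
      refine Fintype.sum_equiv inv.toPerm _ _ fun b => ?_
      simp [PW]
    refine (Finset.sum_le_sum this).trans ?_
    rw [Finset.sum_const, nsmul_eq_mul, Finset.card_erase_of_mem (mem_univ c), Finset.card_univ,
      Nat.cast_sub (Fintype.card_pos_iff.2 ⟨c⟩)]
    simp

theorem match_prob (g : Bool → ℝ) (hg : ∑ b, g b = 1) (b z : Fin n → Bool) :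
    ∑ b', PW g b' * ind (∀ i, z i = true → b' i = b i) = hS g b z := by
  have : ∀ b' : Fin n → Bool, PW g b' * ind (∀ i, z i = true → b' i = b i) =
      ∏ i, (g (b' i) * ind (z i = true → b' i = b i)) := by
    intro b'
    rw [Finset.prod_mul_distrib]
    congr 1
    by_cases h : ∀ i, z i = true → b' i = b i
    · rw [Finset.prod_eq_one fun i _ => by rw [ind, if_pos (h i)], ind, if_pos h]
    · obtain ⟨i, hi⟩ := not_forall.1 h
      rw [Finset.prod_eq_zero (mem_univ i) (by rw [ind, if_neg hi]), ind, if_neg h]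
  simp_rw [this]
  rw [sum_prod_fun (fun i a => g a * ind (z i = true → a = b i))]
  refine Finset.prod_congr rfl fun i _ => ?_
  by_cases h : z i = true
  · simp [h, ind]
  · simp [h, ind]
    simpa using hg

theorem exp2 {K : Type} {α e : ℝ} (hα0 : 0 ≤ α) (hα1 : α ≤ 1) (he0 : 0 ≤ e) (he1 : e ≤ 1)
    (σ : C → K) (B1 : (Fin n → Bool) → (Fin n → Bool) → Prop)
    (B2 : (Fin n → Bool) → Prop) {ρ2 ρ3 θ2 θ3 : ℝ} {J : ℕ} (h2 : 0 ≤ θ2) (h3 : 0 ≤ θ3)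
    (hρ2 : Ex (PW (bern α)) (fun b => Ex (PW (bern (1 - e))) fun z => ind (B1 b z)) ≤ ρ2)
    (hρ3 : Ex (PW (bern (1 - e))) (fun z => ind (B2 z)) ≤ ρ3)
    (hB1 : ∀ b z, ¬ B1 b z → hS (bern α) b z ≤ θ2)
    (hB2 : ∀ z b, ¬ B2 z → hS (fun _ => 1/2) b z ≤ θ3)
    (hJ : ∀ c, (univ.filter (fun c' => σ c' = σ c)).card ≤ J) (c : C) (s : S) :
    Ex (PW (PW (fun _ => 1/2))) (fun u : C → Fin n → Bool =>
      Ex (PW (PW (bern α))) fun v : S → Fin n → Bool => e2 e σ B1 B2 u v c s)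
      ≤ ρ2 + ρ3 + (Fintype.card S - 1 : ℝ) * θ2 + (J - 1 : ℝ) * (Fintype.card S * θ3) := by
  have hU : IsPMF (PW (ι := Fin n) (fun _ : Bool => (1/2 : ℝ))) := PW_pmf half_pmf
  have hV : IsPMF (PW (ι := Fin n) (bern α)) := PW_pmf (bern_pmf hα0 hα1)
  have hZ : IsPMF (PW (ι := Fin n) (bern (1 - e))) :=
    PW_pmf (bern_pmf (by linarith) (by linarith))
  unfold e2
  simp only [Ex_add, Ex_sum]
  refine add_le_add (add_le_add (add_le_add ?_ ?_) ?_) ?_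
  · rw [Ex_const (PW_pmf hU)]
    exact (PW_m1 hV s (fun b => Ex (PW (bern (1 - e))) fun z => ind (B1 b z))).trans_le hρ2
  · rw [Ex_const (PW_pmf hU), Ex_const (PW_pmf hV)]
    exact hρ3
  · have : ∀ s' ∈ univ.erase s, Ex (PW (PW (fun _ => 1/2))) (fun u : C → Fin n → Bool =>
      Ex (PW (PW (bern α))) fun v : S → Fin n → Bool =>
        Ex (PW (bern (1 - e))) fun z => ind (¬ B1 (v s) z) * ind (∀ i, z i = true → v s' i = v s i))
          ≤ θ2 := by
      intro s' hs'
      rw [Ex_const (PW_pmf hU), Ex_comm]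
      refine Ex_le hZ fun z => ?_
      refine (PW_m2 hV (Finset.ne_of_mem_erase hs') (fun a b => ind (¬ B1 a z) *
        ind (∀ i, z i = true → b i = a i))).trans_le ?_
      refine Ex_le hV fun a => ?_
      have := Ex_smul (PW (bern α)) (fun b => ind (∀ i, z i = true → b i = a i)) (ind (¬ B1 a z))
      refine this.trans_le ?_
      unfold Ex
      rw [match_prob _ (bern_pmf hα0 hα1).2]
      by_cases hb : B1 a z
      · simpa [ind, hb] using h2
      · simpa [ind, hb] using hB1 a z hb
    refine (Finset.sum_le_sum this).trans ?_
    rw [Finset.sum_const, nsmul_eq_mul, Finset.card_erase_of_mem (mem_univ s), Finset.card_univ,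
      Nat.cast_sub (Fintype.card_pos_iff.2 ⟨s⟩)]
    simp
  · have : ∀ c' ∈ univ.filter (fun c' => σ c' = σ c ∧ c' ≠ c), ∑ s' : S,
      Ex (PW (PW (fun _ => 1/2))) (fun u : C → Fin n → Bool =>
      Ex (PW (PW (bern α))) fun v : S → Fin n → Bool =>
        Ex (PW (bern (1 - e))) fun z => ind (¬ B2 z) *
          ind (∀ i, z i = true → xr (u c') (v s') i = xr (u c) (v s) i))
          ≤ Fintype.card S * θ3 := by
      intro c' hc'
      rw [← nsmul_eq_mul, ← Finset.card_univ]
      refine Finset.sum_le_card_nsmul _ _ _ fun s' _ => ?_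
      rw [Ex_comm]
      refine Ex_le (PW_pmf hV) fun v => ?_
      rw [Ex_comm]
      refine Ex_le hZ fun z => ?_
      refine (PW_m2 hU (Finset.mem_filter.1 hc').2.2 (fun a b => ind (¬ B2 z) *
        ind (∀ i, z i = true → xr b (v s') i = xr a (v s) i))).trans_le ?_
      refine Ex_le hU fun a => ?_
      refine (Ex_smul _ (fun b => ind (∀ i, z i = true → xr b (v s') i = xr a (v s) i))
        (ind (¬ B2 z))).trans_le ?_
      unfold Ex
      have : ∀ b : Fin n → Bool, (∀ i, z i = true → xr b (v s') i = xr a (v s) i) ↔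
          (∀ i, z i = true → b i = xr (xr a (v s)) (v s') i) := by
        intro b
        refine forall_congr' fun i => imp_congr_right fun _ => ?_
        unfold xr
        cases b i <;> cases a i <;> cases v s i <;> cases v s' i <;> simp
      simp_rw [this]
      rw [match_prob _ half_pmf.2]
      by_cases hb : B2 z
      · simpa [ind, hb] using h3
      · simpa [ind, hb] using hB2 z _ hb
    refine (Finset.sum_le_sum this).trans ?_
    rw [Finset.sum_const, nsmul_eq_mul]
    refine mul_le_mul_of_nonneg_right ?_ (by positivity)
    have e : univ.filter (fun c' => σ c' = σ c ∧ c' ≠ c) = (univ.filter (fun c' => σ c' = σ c)).erase c := by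
      ext x; simp [and_comm]
    have hc : c ∈ univ.filter (fun c' => σ c' = σ c) := by simp
    rw [e, Finset.card_erase_of_mem hc, Nat.cast_sub (Finset.card_pos.2 ⟨c, hc⟩)]
    have : ((univ.filter (fun c' => σ c' = σ c)).card : ℝ) ≤ J := by exact_mod_cast hJ c
    push_cast
    linarith

end core

theorem dec_exists' {C Y : Type} [Nonempty C] (Q : C → Y → Prop) :
    ∃ D : Y → C, ∀ c y, Q c y → D y ≠ c → ∃ c', c' ≠ c ∧ Q c' y := by
  refine ⟨fun y => if h : ∃ c, Q c y then h.choose else Classical.arbitrary C, fun c y hq hd => ?_⟩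
  have hex : ∃ c, Q c y := ⟨c, hq⟩
  simp only [dif_pos hex] at hd
  exact ⟨_, hd, hex.choose_spec⟩

section core
variable {n : ℕ} {C S : Type} [Fintype C] [DecidableEq C] [Fintype S] [DecidableEq S]

theorem det1 [Nonempty C] {p : ℝ} (hp0 : 0 ≤ p) (hp1 : p ≤ 1)
    (T : (Fin n → Bool) → Prop) (u : C → Fin n → Bool) (v : S → Fin n → Bool) :
    ∃ D : (Fin n → Bool) → C, ∀ c s,
      ∑ y, Wn (BSCk p) n (xr (u c) (v s)) y * ind (D y ≠ c) ≤ e1 p T u v c s := by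
  obtain ⟨D, hD⟩ := dec_exists' (C := C) (fun c y => T (xr y (u c)))
  refine ⟨D, fun c s => ?_⟩
  rw [Wn_noise _ _ _ (BSC_noise p)]
  refine Finset.sum_le_sum fun z _ => mul_le_mul_of_nonneg_left ?_
    (PW_nonneg (bern_pmf hp0 hp1).1 z)
  have e' : (fun t => (xr (u c) (v s) t ^^ z t)) = xr (xr (u c) (v s)) z := rfl
  rw [e']
  have h := hD c (xr (xr (u c) (v s)) z)
  have e : xr (xr (xr (u c) (v s)) z) (u c) = xr (v s) z := by
    funext i; simp only [xr]
    cases u c i <;> cases v s i <;> cases z i <;> rfl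
  rw [e] at h
  have n1 : ∀ c' ∈ univ.erase c, 0 ≤ ind (T (xr (xr (xr (u c) (v s)) z) (u c'))) :=
    fun _ _ => ind_nonneg _
  have N1 := Finset.sum_nonneg n1
  have m1 := ind_nonneg (¬ T (xr (v s) z))
  have l := ind_le (D (xr (xr (u c) (v s)) z) ≠ c)
  by_cases ht : T (xr (v s) z)
  · by_cases hd : D (xr (xr (u c) (v s)) z) = c
    · have : ind (D (xr (xr (u c) (v s)) z) ≠ c) = 0 := by simp [ind, hd]
      linarith
    · obtain ⟨c', hc, hT⟩ := h ht hd
      have := Finset.single_le_sum n1 (Finset.mem_erase.2 ⟨hc, mem_univ c'⟩)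
      have i3 : ind (T (xr (xr (xr (u c) (v s)) z) (u c'))) = 1 := by rw [ind, if_pos hT]
      rw [i3] at this
      linarith
  · have : ind (¬ T (xr (v s) z)) = 1 := by rw [ind, if_pos ht]
    linarith

theorem det2 [Nonempty C] [Nonempty S] {K : Type} {e : ℝ} (he0 : 0 ≤ e) (he1 : e ≤ 1)
    (σ : C → K) (B1 : (Fin n → Bool) → (Fin n → Bool) → Prop)
    (B2 : (Fin n → Bool) → Prop) (u : C → Fin n → Bool) (v : S → Fin n → Bool) :
    ∃ D : (Fin n → Option Bool) × K → C × S, ∀ c s,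
      ∑ y, Wn (BECk e) n (xr (u c) (v s)) y * ind (D (y, σ c) ≠ (c, s)) ≤
        e2 e σ B1 B2 u v c s := by
  obtain ⟨D, hD⟩ := dec_exists' (C := C × S) (Y := (Fin n → Option Bool) × K)
    (fun c y => σ c.1 = y.2 ∧ ∀ i b, y.1 i = some b → xr (u c.1) (v c.2) i = b)
  refine ⟨D, fun c s => ?_⟩
  rw [Wn_noise _ _ _ (BEC_noise e)]
  refine Finset.sum_le_sum fun z _ => mul_le_mul_of_nonneg_left ?_
    (PW_nonneg (bern_pmf (by linarith) (by linarith)).1 z)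
  set y : Fin n → Option Bool := fun t => eapp (xr (u c) (v s) t) (z t) with hy
  have n1 : ∀ s' ∈ univ.erase s, 0 ≤ ind (¬ B1 (v s) z) * ind (∀ i, z i = true → v s' i = v s i) :=
    fun _ _ => mul_nonneg (ind_nonneg _) (ind_nonneg _)
  have n2' : ∀ c' s', 0 ≤ ind (¬ B2 z) *
      ind (∀ i, z i = true → xr (u c') (v s') i = xr (u c) (v s) i) :=
    fun _ _ => mul_nonneg (ind_nonneg _) (ind_nonneg _)
  have n2 : ∀ c' ∈ univ.filter (fun c' => σ c' = σ c ∧ c' ≠ c), 0 ≤ ∑ s', ind (¬ B2 z) *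
      ind (∀ i, z i = true → xr (u c') (v s') i = xr (u c) (v s) i) :=
    fun _ _ => Finset.sum_nonneg fun _ _ => n2' _ _
  have N1 := Finset.sum_nonneg n1
  have N2 := Finset.sum_nonneg n2
  have m1 := ind_nonneg (B1 (v s) z)
  have m2 := ind_nonneg (B2 z)
  have l := ind_le (D (y, σ c) ≠ (c, s))
  by_cases b1 : B1 (v s) z
  · have : ind (B1 (v s) z) = 1 := by simp [ind, b1]
    linarith
  by_cases b2 : B2 z
  · have : ind (B2 z) = 1 := by simp [ind, b2]
    linarith
  by_cases hd : D (y, σ c) = (c, s)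
  · have : ind (D (y, σ c) ≠ (c, s)) = 0 := by simp [ind, hd]
    linarith
  have i1 : ind (¬ B1 (v s) z) = 1 := by simp [ind, b1]
  have i2 : ind (¬ B2 z) = 1 := by simp [ind, b2]
  obtain ⟨⟨c', s'⟩, hne, hσ, hm⟩ := hD (c, s) (y, σ c) ⟨rfl, by
    intro i b hb
    simp only [hy, eapp] at hb
    split_ifs at hb
    simpa using hb⟩ hd
  simp only at hσ hm
  have hm' : ∀ i, z i = true → xr (u c') (v s') i = xr (u c) (v s) i := by
    intro i hi
    refine hm i _ ?_
    simp [hy, eapp, hi]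
  by_cases hc : c' = c
  · subst hc
    have hs : s' ≠ s := fun h => hne (by rw [h])
    have := Finset.single_le_sum n1 (Finset.mem_erase.2 ⟨hs, mem_univ s'⟩)
    rw [i1, one_mul, ind, if_pos (by
      intro i hi
      have := hm' i hi
      simp only [xr] at this
      revert this
      cases u c' i <;> cases v s i <;> cases v s' i <;> simp)] at this
    rw [← i1] at this
    linarith
  · have h1 := Finset.single_le_sum n2 (Finset.mem_filter.2 ⟨mem_univ c', hσ, hc⟩)
    have h2 := Finset.single_le_sum (fun s' _ => n2' c' s') (mem_univ s')
    have h3 := h2.trans h1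
    have i3 : ind (∀ i, z i = true → xr (u c') (v s') i = xr (u c) (v s) i) = 1 := by
      rw [ind, if_pos hm']
    rw [i3, i2, one_mul, ← i2] at h3
    linarith

theorem core [Nonempty C] [Nonempty S] {K : Type} {α p e : ℝ} (hα0 : 0 ≤ α) (hα1 : α ≤ 1)
    (hp0 : 0 ≤ p) (hp1 : p ≤ 1) (he0 : 0 ≤ e) (he1 : e ≤ 1)
    (T : (Fin n → Bool) → Prop)
    (σ : C → K) (B1 : (Fin n → Bool) → (Fin n → Bool) → Prop)
    (B2 : (Fin n → Bool) → Prop) {ρ1 ρ2 ρ3 τ θ2 θ3 : ℝ} {J : ℕ} (h2 : 0 ≤ θ2) (h3 : 0 ≤ θ3)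
    (hρ : Ex (PW (bern α)) (fun b => Ex (PW (bern p)) fun z => ind (¬ T (xr b z))) ≤ ρ1)
    (hτ : ∑ w, (1/2:ℝ) ^ n * ind (T w) ≤ τ)
    (hρ2 : Ex (PW (bern α)) (fun b => Ex (PW (bern (1 - e))) fun z => ind (B1 b z)) ≤ ρ2)
    (hρ3 : Ex (PW (bern (1 - e))) (fun z => ind (B2 z)) ≤ ρ3)
    (hB1 : ∀ b z, ¬ B1 b z → hS (bern α) b z ≤ θ2)
    (hB2 : ∀ z b, ¬ B2 z → hS (fun _ => 1/2) b z ≤ θ3)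
    (hJ : ∀ c, (univ.filter (fun c' => σ c' = σ c)).card ≤ J) :
    ∃ (x : C → S → Fin n → Bool) (D1 : (Fin n → Bool) → C)
      (D2 : (Fin n → Option Bool) × K → C × S),
      1 / ((Fintype.card C : ℝ) * Fintype.card S) * ∑ c, ∑ s,
        (∑ y, Wn (BSCk p) n (x c s) y * ind (D1 y ≠ c) +
         ∑ y, Wn (BECk e) n (x c s) y * ind (D2 (y, σ c) ≠ (c, s))) ≤
      (ρ1 + (Fintype.card C - 1 : ℝ) * τ) +
        (ρ2 + ρ3 + (Fintype.card S - 1 : ℝ) * θ2 + (J - 1 : ℝ) * (Fintype.card S * θ3)) := by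
  set B := (ρ1 + (Fintype.card C - 1 : ℝ) * τ) +
        (ρ2 + ρ3 + (Fintype.card S - 1 : ℝ) * θ2 + (J - 1 : ℝ) * (Fintype.card S * θ3)) with hB
  have cC : (0:ℝ) < Fintype.card C := by exact_mod_cast Fintype.card_pos
  have cS : (0:ℝ) < Fintype.card S := by exact_mod_cast Fintype.card_pos
  have hU : IsPMF (PW (ι := C) (PW (ι := Fin n) (fun _ : Bool => (1/2 : ℝ)))) :=
    PW_pmf (PW_pmf half_pmf)
  have hV : IsPMF (PW (ι := S) (PW (ι := Fin n) (bern α))) := PW_pmf (PW_pmf (bern_pmf hα0 hα1))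
  have key : Ex (PW (PW (fun _ => 1/2))) (fun u : C → Fin n → Bool =>
      Ex (PW (PW (bern α))) fun v : S → Fin n → Bool =>
        ∑ c, ∑ s, (e1 p T u v c s + e2 e σ B1 B2 u v c s))
        ≤ (Fintype.card C : ℝ) * Fintype.card S * B := by
    simp only [Ex_sum, Ex_add]
    have : ∀ c ∈ (univ : Finset C), ∀ s ∈ (univ : Finset S), _ ≤ B := fun c _ s _ =>
      add_le_add (exp1 hα0 hα1 hp0 hp1 T hρ hτ c s)
        (exp2 hα0 hα1 he0 he1 σ B1 B2 h2 h3 hρ2 hρ3 hB1 hB2 hJ c s)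
    refine (Finset.sum_le_sum fun c hc => Finset.sum_le_sum (this c hc)).trans ?_
    simp [mul_assoc]
  obtain ⟨u, hu⟩ := Ex_exists hU key
  obtain ⟨v, hv⟩ := Ex_exists hV hu
  obtain ⟨D1, hD1⟩ := det1 hp0 hp1 T u v
  obtain ⟨D2, hD2⟩ := det2 he0 he1 σ B1 B2 u v
  refine ⟨fun c s => xr (u c) (v s), D1, D2, ?_⟩
  rw [one_div, inv_mul_le_iff₀ (by positivity)]
  refine le_trans ?_ hv
  exact Finset.sum_le_sum fun c _ => Finset.sum_le_sum fun s _ => add_le_add (hD1 c s) (hD2 c s)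

end core

theorem Hb_ln (x : ℝ) : Hb x * Real.log 2 = -(x * Real.log x) - (1 - x) * Real.log (1 - x) := by
  have : Real.log 2 ≠ 0 := (Real.log_pos (by norm_num)).ne'
  unfold Hb Real.logb
  field_simp

theorem bern_conv {α p : ℝ} (hα0 : 0 ≤ α) (hα1 : α ≤ 1) (hp0 : 0 ≤ p) (hp1 : p ≤ 1) (b z : Bool) :
    bern α b * bern p z ≤ bern (bconv α p) (b ^^ z) := by
  have a1 : 0 ≤ α * p := by positivity
  have a2 : 0 ≤ α * (1 - p) := mul_nonneg hα0 (by linarith)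
  have a3 : 0 ≤ (1 - α) * p := mul_nonneg (by linarith) hp0
  have a4 : 0 ≤ (1 - α) * (1 - p) := mul_nonneg (by linarith) (by linarith)
  cases b <;> cases z <;> simp [bern, bconv] <;> nlinarith

theorem chern1 {α p A : ℝ} (hα0 : 0 ≤ α) (hα1 : α ≤ 1) (hp0 : 0 ≤ p) (hp1 : p ≤ 1) {a : ℝ}
    (ha : 0 < a) (hA : Real.log a = - A * Real.log 2) (h : Hb (bconv α p) < A) :
    ∃ r : ℝ, 0 ≤ r ∧ r < 1 ∧ ∀ n : ℕ,
      Ex (PW (bern α)) (fun b : Fin n → Bool => Ex (PW (bern p)) fun z =>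
        ind (¬ a ^ n ≤ PW (bern (bconv α p)) (xr b z))) ≤ r ^ n := by
  have l2 : 0 < Real.log 2 := Real.log_pos (by norm_num)
  have pos : ∀ l : Bool × Bool, bern α l.1 * bern p l.2 ≠ 0 →
      0 < bern (bconv α p) (l.1 ^^ l.2) := by
    intro l hl
    have := mul_nonneg ((bern_pmf hα0 hα1).1 l.1) ((bern_pmf hp0 hp1).1 l.2)
    exact lt_of_lt_of_le (lt_of_le_of_ne this hl.symm) (bern_conv hα0 hα1 hp0 hp1 _ _)
  obtain ⟨r, r0, r1, hr⟩ := chern (P := fun l : Bool × Bool => bern α l.1 * bern p l.2)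
    (h := fun l => a / bern (bconv α p) (l.1 ^^ l.2))
    (pmf_prod (bern_pmf hα0 hα1) (bern_pmf hp0 hp1)) (fun l hl => div_pos ha (pos l hl)) (by
      have : ∀ l : Bool × Bool, bern α l.1 * bern p l.2 *
          Real.log (a / bern (bconv α p) (l.1 ^^ l.2)) = bern α l.1 * bern p l.2 *
          (Real.log a - Real.log (bern (bconv α p) (l.1 ^^ l.2))) := by
        intro l
        by_cases hl : bern α l.1 * bern p l.2 = 0
        · rw [hl]; ring
        · rw [Real.log_div ha.ne' (pos l hl).ne']
      simp only [this]
      rw [Fintype.sum_prod_type]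
      simp only [Fintype.sum_bool, bern, hA]
      norm_num
      have e1 := Hb_ln (bconv α p)
      have e2 := mul_lt_mul_of_pos_right h l2
      rw [e1] at e2
      have e3 : bconv α p = α * (1 - p) + (1 - α) * p := rfl
      generalize Real.log (bconv α p) = x at *
      generalize Real.log (1 - bconv α p) = y at *
      rw [e3] at e2
      nlinarith)
  refine ⟨r, r0, r1, fun n => ?_⟩
  have e := PW_pair (ι := Fin n) (bern α) (bern p)
    (fun b z => ind (¬ a ^ n ≤ PW (bern (bconv α p)) (xr b z)))
  refine e.trans_le ?_
  refine hr n (fun w => ¬ a ^ n ≤ PW (bern (bconv α p)) (xr (fun i => (w i).1) (fun i => (w i).2))) ?_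
  intro w hw hev
  push Not at hev
  rw [Finset.prod_div_distrib, Finset.prod_const, Finset.card_univ, Fintype.card_fin,
    le_div_iff₀ (Finset.prod_pos fun i _ => pos _ (hw i)), one_mul]
  exact hev.le

theorem chern2 {α e A : ℝ} (hα0 : 0 ≤ α) (hα1 : α ≤ 1) (he0 : 0 ≤ e) (he1 : e ≤ 1) {a : ℝ}
    (ha : 0 < a) (hA : Real.log a = - A * Real.log 2) (h : A < (1 - e) * Hb α) :
    ∃ r : ℝ, 0 ≤ r ∧ r < 1 ∧ ∀ n : ℕ,
      Ex (PW (bern α)) (fun b : Fin n → Bool => Ex (PW (bern (1 - e))) fun z =>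
        ind (a ^ n ≤ hS (bern α) b z)) ≤ r ^ n := by
  have l2 : 0 < Real.log 2 := Real.log_pos (by norm_num)
  have hz : IsPMF (bern (1 - e)) := bern_pmf (by linarith) (by linarith)
  have pos : ∀ l : Bool × Bool, bern α l.1 * bern (1 - e) l.2 ≠ 0 →
      0 < if l.2 then bern α l.1 else 1 := by
    intro l hl
    split_ifs
    · exact lt_of_le_of_ne ((bern_pmf hα0 hα1).1 l.1) (left_ne_zero_of_mul hl).symm
    · norm_num
  obtain ⟨r, r0, r1, hr⟩ := chern (P := fun l : Bool × Bool => bern α l.1 * bern (1 - e) l.2)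
    (h := fun l => (if l.2 then bern α l.1 else 1) / a)
    (pmf_prod (bern_pmf hα0 hα1) hz) (fun l hl => div_pos (pos l hl) ha) (by
      have : ∀ l : Bool × Bool, bern α l.1 * bern (1 - e) l.2 *
          Real.log ((if l.2 then bern α l.1 else 1) / a) = bern α l.1 * bern (1 - e) l.2 *
          (Real.log (if l.2 then bern α l.1 else 1) - Real.log a) := by
        intro l
        by_cases hl : bern α l.1 * bern (1 - e) l.2 = 0
        · rw [hl]; ring
        · rw [Real.log_div (pos l hl).ne' ha.ne']
      simp only [this]
      rw [Fintype.sum_prod_type]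
      simp only [Fintype.sum_bool, bern, hA]
      norm_num
      have e1 := Hb_ln α
      have e2 := mul_lt_mul_of_pos_right h l2
      rw [mul_assoc, e1] at e2
      generalize Real.log α = x at *
      generalize Real.log (1 - α) = y at *
      nlinarith)
  refine ⟨r, r0, r1, fun n => ?_⟩
  have e := PW_pair (ι := Fin n) (bern α) (bern (1 - e))
    (fun b z => ind (a ^ n ≤ hS (bern α) b z))
  refine e.trans_le ?_
  refine hr n (fun w => a ^ n ≤ hS (bern α) (fun i => (w i).1) (fun i => (w i).2)) ?_
  intro w hw hev
  rw [Finset.prod_div_distrib, Finset.prod_const, Finset.card_univ, Fintype.card_fin,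
    le_div_iff₀ (pow_pos ha n), one_mul]
  exact hev

theorem chern3 {e A : ℝ} (he0 : 0 ≤ e) (he1 : e ≤ 1) {a : ℝ}
    (ha : 0 < a) (hA : Real.log a = - A * Real.log 2) (h : A < 1 - e) :
    ∃ r : ℝ, 0 ≤ r ∧ r < 1 ∧ ∀ n : ℕ,
      Ex (PW (bern (1 - e))) (fun z : Fin n → Bool =>
        ind (a ^ n ≤ hS (fun _ => 1/2) z z)) ≤ r ^ n := by
  have l2 : 0 < Real.log 2 := Real.log_pos (by norm_num)
  have hz : IsPMF (bern (1 - e)) := bern_pmf (by linarith) (by linarith)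
  have pos : ∀ l : Bool, 0 < if l then (1/2 : ℝ) else 1 := by
    intro l; split_ifs <;> norm_num
  obtain ⟨r, r0, r1, hr⟩ := chern (P := bern (1 - e))
    (h := fun l => (if l then (1/2:ℝ) else 1) / a) hz (fun l hl => div_pos (pos l) ha) (by
      have : ∀ l : Bool, bern (1 - e) l * Real.log ((if l then (1/2:ℝ) else 1) / a) =
          bern (1 - e) l * (Real.log (if l then (1/2:ℝ) else 1) - Real.log a) := by
        intro l
        rw [Real.log_div (pos l).ne' ha.ne']
      simp only [this]
      simp only [Fintype.sum_bool, bern, hA]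
      norm_num
      have e2 := mul_lt_mul_of_pos_right h l2
      have e3 : Real.log (1/2) = - Real.log 2 := by rw [one_div, Real.log_inv]
      rw [e3]
      nlinarith)
  refine ⟨r, r0, r1, fun n => ?_⟩
  refine hr n (fun w => a ^ n ≤ hS (fun _ => 1/2) w w) ?_
  intro w hw hev
  rw [Finset.prod_div_distrib, Finset.prod_const, Finset.card_univ, Fintype.card_fin,
    le_div_iff₀ (pow_pos ha n), one_mul]
  exact hev

theorem asymp {α p e A1 A2 A3 : ℝ} (hα0 : 0 ≤ α) (hα1 : α ≤ 1) (hp0 : 0 ≤ p) (hp1 : p ≤ 1)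
    (he0 : 0 ≤ e) (he1 : e ≤ 1)
    (h1 : Hb (bconv α p) < A1) (h2 : A2 < (1 - e) * Hb α) (h3 : A3 < 1 - e) :
    ∃ r1 r2 r3 : ℝ, 0 ≤ r1 ∧ r1 < 1 ∧ 0 ≤ r2 ∧ r2 < 1 ∧ 0 ≤ r3 ∧ r3 < 1 ∧
    ∀ (n : ℕ) (C S K : Type) [Fintype C] [DecidableEq C] [Fintype S] [DecidableEq S]
      [Nonempty C] [Nonempty S] (σ : C → K) (J : ℕ)
      (_ : ∀ c, (univ.filter (fun c' => σ c' = σ c)).card ≤ J),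
    ∃ (x : C → S → Fin n → Bool) (D1 : (Fin n → Bool) → C)
      (D2 : (Fin n → Option Bool) × K → C × S),
      1 / ((Fintype.card C : ℝ) * Fintype.card S) * ∑ c, ∑ s,
        (∑ y, Wn (BSCk p) n (x c s) y * ind (D1 y ≠ c) +
         ∑ y, Wn (BECk e) n (x c s) y * ind (D2 (y, σ c) ≠ (c, s))) ≤
      (r1 ^ n + (Fintype.card C - 1 : ℝ) * (2:ℝ) ^ ((A1 - 1) * n)) +
        (r2 ^ n + r3 ^ n + (Fintype.card S - 1 : ℝ) * (2:ℝ) ^ (- A2 * n) +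
          (J - 1 : ℝ) * (Fintype.card S * (2:ℝ) ^ (- A3 * n))) := by
  have lg : ∀ A : ℝ, Real.log ((2:ℝ) ^ (-A)) = -A * Real.log 2 := fun A =>
    Real.log_rpow (by norm_num) _
  have ps : ∀ A : ℝ, 0 < (2:ℝ) ^ (-A) := fun A => Real.rpow_pos_of_pos (by norm_num) _
  obtain ⟨r1, r10, r11, H1⟩ := chern1 hα0 hα1 hp0 hp1 (ps A1) (lg A1) h1
  obtain ⟨r2, r20, r21, H2⟩ := chern2 hα0 hα1 he0 he1 (ps A2) (lg A2) h2
  obtain ⟨r3, r30, r31, H3⟩ := chern3 he0 he1 (ps A3) (lg A3) h3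
  refine ⟨r1, r2, r3, r10, r11, r20, r21, r30, r31, ?_⟩
  intro n C S K _ _ _ _ _ _ σ J hJ
  have pw : ∀ A : ℝ, (2:ℝ) ^ (A * n) = ((2:ℝ) ^ A) ^ n := fun A => Real.rpow_mul_natCast (by norm_num) A n
  obtain ⟨q0, q1⟩ := bconv_mem hα0 hα1 hp0 hp1
  have hq : IsPMF (PW (ι := Fin n) (bern (bconv α p))) := PW_pmf (bern_pmf q0 q1)
  refine core hα0 hα1 hp0 hp1 he0 he1 (fun w => ((2:ℝ) ^ (-A1)) ^ n ≤ PW (bern (bconv α p)) w)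
    σ (fun b z => ((2:ℝ) ^ (-A2)) ^ n ≤ hS (bern α) b z)
    (fun z => ((2:ℝ) ^ (-A3)) ^ n ≤ hS (fun _ => 1/2) z z) (by positivity) (by positivity)
    (H1 n) ?_ (H2 n) (H3 n) ?_ ?_ hJ
  · have t0 : 0 < ((2:ℝ) ^ (-A1)) ^ n := pow_pos (ps A1) n
    have : ∀ w ∈ (univ : Finset (Fin n → Bool)), (1/2:ℝ) ^ n *
        ind (((2:ℝ) ^ (-A1)) ^ n ≤ PW (bern (bconv α p)) w) ≤
        (1/2:ℝ) ^ n * (PW (bern (bconv α p)) w / ((2:ℝ) ^ (-A1)) ^ n) := by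
      intro w _
      refine mul_le_mul_of_nonneg_left ?_ (by positivity)
      unfold ind
      split_ifs with h
      · rwa [le_div_iff₀ t0, one_mul]
      · exact div_nonneg (hq.1 w) t0.le
    refine (Finset.sum_le_sum this).trans ?_
    rw [← Finset.mul_sum, ← Finset.sum_div, hq.2, pw, ← one_div_pow, ← mul_pow]
    refine le_of_eq ?_
    congr 1
    rw [Real.rpow_sub (by norm_num), Real.rpow_neg (by norm_num)]
    norm_num
    ring
  · intro b z h
    rw [pw]
    push Not at h
    exact h.le
  · intro z b h
    rw [pw]
    push Not at h
    exact h.le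

theorem msg_bound {p e : ℝ} (W : Bool → Bool × Option Bool → ℝ) (hW : IsChannel W)
    (hm1 : ∀ x y, margW1 W x y = BSCk p x y) (hm2 : ∀ x y, margW2 W x y = BECk e x y)
    (n : ℕ) (x : Fin n → Bool) (G : (Fin n → Bool) × (Fin n → Option Bool) → Prop)
    (A : (Fin n → Bool) → Prop) (B : (Fin n → Option Bool) → Prop)
    (h : ∀ y, ¬ A y.1 → ¬ B y.2 → G y) :
    ∑ y : (Fin n → Bool) × (Fin n → Option Bool), nFold W n x y * ind (¬ G y) ≤
      ∑ y, Wn (BSCk p) n x y * ind (A y) + ∑ y, Wn (BECk e) n x y * ind (B y) := by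
  have w1 : margW1 W = BSCk p := by funext x y; exact hm1 x y
  have w2 : margW2 W = BECk e := by funext x y; exact hm2 x y
  rw [← w1, ← w2, ← marg1_ev, ← marg2_ev, ← Finset.sum_add_distrib]
  refine Finset.sum_le_sum fun y _ => ?_
  rw [← mul_add]
  refine mul_le_mul_of_nonneg_left ?_ (nFold_nonneg W hW n x y)
  have a0 := ind_nonneg (A y.1)
  have b0 := ind_nonneg (B y.2)
  by_cases hA : A y.1
  · have : ind (A y.1) = 1 := by rw [ind, if_pos hA]
    linarith [ind_le (¬ G y)]
  by_cases hB : B y.2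
  · have : ind (B y.2) = 1 := by rw [ind, if_pos hB]
    linarith [ind_le (¬ G y)]
  have : ind (¬ G y) = 0 := by rw [ind, if_neg (not_not.2 (h y hA hB))]
  linarith

theorem ite01 (G : Prop) [Decidable G] : (if G then (0:ℝ) else 1) = ind (¬ G) := by
  by_cases h : G
  · rw [if_pos h, ind, if_neg (not_not.2 h)]
  · rw [if_neg h, ind, if_pos h]

/-- message set size -/
def kk (R : ℝ) (n : ℕ) : ℕ := ⌈(2:ℝ) ^ (R * n)⌉₊

theorem kk_pos (R : ℝ) (n : ℕ) : 0 < kk R n := Nat.ceil_pos.2 (by positivity)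

theorem kk_zero (n : ℕ) : kk 0 n = 1 := by simp [kk]

theorem kk_ge (R : ℝ) (n : ℕ) : (2:ℝ) ^ (R * n) ≤ kk R n := Nat.le_ceil _

theorem kk_le {R : ℝ} (hR : 0 ≤ R) (n : ℕ) : (kk R n : ℝ) ≤ 2 * (2:ℝ) ^ (R * n) := by
  have h1 : (1:ℝ) ≤ (2:ℝ) ^ (R * n) := Real.one_le_rpow (by norm_num) (by positivity)
  have := (Nat.ceil_lt_add_one (by positivity : 0 ≤ (2:ℝ) ^ (R * n))).le
  unfold kk; linarith

theorem kk_rate (R : ℝ) {n : ℕ} (hn : 0 < n) : R * n ≤ Real.logb 2 (kk R n) := by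
  rw [Real.le_logb_iff_rpow_le (by norm_num) (by exact_mod_cast kk_pos R n)]
  exact kk_ge R n

theorem lim_exp {g : ℕ → ℝ} {M γ : ℝ} (hγ : 0 < γ) (h0 : ∀ n, 0 ≤ g n)
    (h : ∀ n, g n ≤ M * (2:ℝ) ^ (-γ * n)) : Filter.Tendsto g Filter.atTop (nhds 0) := by
  refine squeeze_zero h0 h ?_
  have : ∀ n : ℕ, M * (2:ℝ) ^ (-γ * n) = M * ((2:ℝ) ^ (-γ)) ^ n := fun n => by
    rw [Real.rpow_mul_natCast (by norm_num)]
  simp_rw [this]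
  have := (tendsto_pow_atTop_nhds_zero_of_lt_one (by positivity)
    (Real.rpow_lt_one_of_one_lt_of_neg (by norm_num : (1:ℝ) < 2) (by linarith : -γ < 0))).const_mul M
  simpa using this

theorem one_le_kk (R : ℝ) (n : ℕ) : (1:ℝ) ≤ kk R n := by exact_mod_cast kk_pos R n

theorem lim_a {R A : ℝ} (hR : 0 ≤ R) (h : R = 0 ∨ R < A) :
    Filter.Tendsto (fun n : ℕ => ((kk R n : ℝ) - 1) * (2:ℝ) ^ (-A * n)) Filter.atTop (nhds 0) := by
  rcases h with rfl | h
  · simp [kk_zero]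
  · refine lim_exp (M := 2) (γ := A - R) (by linarith)
      (fun n => mul_nonneg (by linarith [one_le_kk R n]) (by positivity)) fun n => ?_
    have e : (2:ℝ) ^ (-(A - R) * n) = (2:ℝ) ^ (R * n) * (2:ℝ) ^ (-A * n) := by
      rw [← Real.rpow_add (by norm_num)]; ring_nf
    rw [e, ← mul_assoc]
    refine mul_le_mul_of_nonneg_right ?_ (by positivity)
    linarith [kk_le hR n]

theorem lim_b {R R' A : ℝ} (hR : 0 ≤ R) (hR' : 0 ≤ R') (h : R = 0 ∨ R + R' < A) :
    Filter.Tendsto (fun n : ℕ => ((kk R n : ℝ) - 1) * (kk R' n * (2:ℝ) ^ (-A * n)))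
      Filter.atTop (nhds 0) := by
  rcases h with rfl | h
  · simp [kk_zero]
  · refine lim_exp (M := 4) (γ := A - R - R') (by linarith)
      (fun n => mul_nonneg (by linarith [one_le_kk R n]) (by positivity)) fun n => ?_
    have e : (2:ℝ) ^ (-(A - R - R') * n) = (2:ℝ) ^ (R * n) * (2:ℝ) ^ (R' * n) * (2:ℝ) ^ (-A * n) := by
      rw [← Real.rpow_add (by norm_num), ← Real.rpow_add (by norm_num)]; ring_nf
    rw [e, ← mul_assoc, ← mul_assoc]
    refine mul_le_mul_of_nonneg_right ?_ (by positivity)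
    calc ((kk R n : ℝ) - 1) * kk R' n ≤ (2 * (2:ℝ) ^ (R * n)) * (2 * (2:ℝ) ^ (R' * n)) :=
          mul_le_mul (by linarith [kk_le hR n]) (kk_le hR' n) (by positivity) (by positivity)
      _ = _ := by ring

theorem lim_c {R R' A : ℝ} (hR : 0 ≤ R) (hR' : 0 ≤ R') (h : R + R' = 0 ∨ R + R' < A) :
    Filter.Tendsto (fun n : ℕ => ((kk R n : ℝ) * kk R' n - 1) * (2:ℝ) ^ (-A * n))
      Filter.atTop (nhds 0) := by
  rcases h with h | h
  · have h1 : R = 0 := by linarith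
    have h2 : R' = 0 := by linarith
    simp [h1, h2, kk_zero]
  · refine lim_exp (M := 4) (γ := A - R - R') (by linarith)
      (fun n => mul_nonneg (by nlinarith [one_le_kk R n, one_le_kk R' n]) (by positivity))
      fun n => ?_
    have e : (2:ℝ) ^ (-(A - R - R') * n) = (2:ℝ) ^ (R * n) * (2:ℝ) ^ (R' * n) * (2:ℝ) ^ (-A * n) := by
      rw [← Real.rpow_add (by norm_num), ← Real.rpow_add (by norm_num)]; ring_nf
    rw [e, ← mul_assoc]
    refine mul_le_mul_of_nonneg_right ?_ (by positivity)
    calc ((kk R n : ℝ) * kk R' n - 1) ≤ kk R n * kk R' n := by linarith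
      _ ≤ (2 * (2:ℝ) ^ (R * n)) * (2 * (2:ℝ) ^ (R' * n)) :=
          mul_le_mul (kk_le hR n) (kk_le hR' n) (by positivity) (by positivity)
      _ = _ := by ring

theorem pick_below {b R : ℝ} {P : Prop} (h : P ∨ R < b) : ∃ A, A < b ∧ (P ∨ R < A) := by
  rcases h with h | h
  · exact ⟨b - 1, by linarith, Or.inl h⟩
  · exact ⟨(b + R) / 2, by linarith, Or.inr (by linarith)⟩

section
variable {p e : ℝ} (W : Bool → Bool × Option Bool → ℝ)

theorem ach2 (hp0 : 0 ≤ p) (hp1 : p ≤ 1) (he0 : 0 ≤ e) (he1 : e ≤ 1) (hW : IsChannel W)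
    (hm1 : ∀ x y, margW1 W x y = BSCk p x y) (hm2 : ∀ x y, margW2 W x y = BECk e x y)
    {α : ℝ} (hα0 : 0 ≤ α) (hα1 : α ≤ 1) {R1 Ra Rb : ℝ} (h1 : 0 ≤ R1) (ha : 0 ≤ Ra) (hb : 0 ≤ Rb)
    (c1 : R1 + Ra = 0 ∨ R1 + Ra < 1 - Hb (bconv α p))
    (c2 : Rb = 0 ∨ Rb < (1 - e) * Hb α) (c3 : Ra = 0 ∨ Ra + Rb < 1 - e) :
    Ach2 W (R1, Ra + Rb) := by
  refine ⟨h1, add_nonneg ha hb, fun ε hε => ?_⟩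
  obtain ⟨A1, a1, d1⟩ := pick_below c1
  obtain ⟨A2, a2, d2⟩ := pick_below c2
  obtain ⟨A3, a3, d3⟩ := pick_below c3
  obtain ⟨r1, r2, r3, r10, r11, r20, r21, r30, r31, H⟩ :=
    asymp (A1 := 1 - A1) hα0 hα1 hp0 hp1 he0 he1 (by linarith) a2 a3
  have L := (((tendsto_pow_atTop_nhds_zero_of_lt_one r10 r11).add (lim_c h1 ha d1)).add
    ((((tendsto_pow_atTop_nhds_zero_of_lt_one r20 r21).add
      (tendsto_pow_atTop_nhds_zero_of_lt_one r30 r31)).add (lim_a hb d2)).add (lim_b ha hb d3)))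
  simp only [add_zero] at L
  obtain ⟨n, hn, hn0⟩ := ((L.eventually (gt_mem_nhds hε)).and
    (Filter.eventually_gt_atTop 0)).exists
  set k := kk R1 n with hk
  set j := kk Ra n with hj
  set l := kk Rb n with hl
  have k0 : 0 < k := kk_pos _ _
  have j0 : 0 < j := kk_pos _ _
  have l0 : 0 < l := kk_pos _ _
  have : NeZero k := ⟨k0.ne'⟩
  have : NeZero j := ⟨j0.ne'⟩
  have : NeZero l := ⟨l0.ne'⟩
  have nR : (0:ℝ) < n := by exact_mod_cast hn0
  obtain ⟨x, D1, D2, hD⟩ := H n (Fin k × Fin j) (Fin l) (Fin k) Prod.fst j (by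
    intro c
    refine le_trans (Finset.card_le_card (t := univ.image (fun b : Fin j => (c.1, b))) ?_) ?_
    · intro x hx
      simp only [mem_filter, mem_univ, true_and, mem_image] at hx ⊢
      exact ⟨x.2, by rw [← hx]⟩
    · refine Finset.card_image_le.trans ?_
      simp)
  let E : (Fin k × Fin j) × Fin l ≃ Fin k × Fin (j * l) :=
    (Equiv.prodAssoc _ _ _).trans (Equiv.prodCongr (Equiv.refl _) finProdFinEquiv)
  refine ⟨n, k, j * l, hn0, k0, Nat.mul_pos j0 l0,
    fun m => x (E.symm m).1 (E.symm m).2, fun y => (D1 y).1,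
    fun y => finProdFinEquiv ((D2 y).1.2, (D2 y).2), ?_, ?_, ?_⟩
  · rw [le_div_iff₀ nR]; exact kk_rate R1 hn0
  · rw [le_div_iff₀ nR]
    push_cast
    rw [Real.logb_mul (by exact_mod_cast j0.ne') (by exact_mod_cast l0.ne')]
    have := kk_rate Ra hn0
    have := kk_rate Rb hn0
    linarith
  · refine le_trans ?_ hn.le
    refine le_trans ?_ (hD.trans (le_of_eq ?_))
    · unfold errP2
      simp only [Fintype.card_prod, Fintype.card_fin]
      push_cast
      rw [← mul_assoc (k:ℝ)]
      refine mul_le_mul_of_nonneg_left ?_ (by positivity)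
      rw [← Equiv.sum_comp E, Fintype.sum_prod_type]
      refine Finset.sum_le_sum fun c _ => Finset.sum_le_sum fun s _ => ?_
      set cs := (c, s) with hcs
      simp only [Equiv.symm_apply_apply]
      have hEx : E cs = (cs.1.1, finProdFinEquiv (cs.1.2, cs.2)) := rfl
      have := msg_bound W hW hm1 hm2 n (x cs.1 cs.2)
        (fun y => (D1 y.1).1 = (E cs).1 ∧
          finProdFinEquiv ((D2 (y.2, (E cs).1)).1.2, (D2 (y.2, (E cs).1)).2) = (E cs).2)
        (fun y => D1 y ≠ cs.1) (fun y => D2 (y, cs.1.1) ≠ (cs.1, cs.2)) (by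
          intro y hA hB
          rw [not_not] at hA hB
          rw [hEx]
          simp only [hA, hB, and_self])
      refine le_trans (le_of_eq ?_) this
      refine Finset.sum_congr rfl fun y _ => ?_
      exact congrArg _ (ite01 _)
    · simp only [Fintype.card_prod, Fintype.card_fin]
      push_cast
      rw [show (1 - A1 - 1) = - A1 by ring]

theorem ach0 (hp0 : 0 ≤ p) (hp1 : p ≤ 1) (he0 : 0 ≤ e) (he1 : e ≤ 1) (hW : IsChannel W)
    (hm1 : ∀ x y, margW1 W x y = BSCk p x y) (hm2 : ∀ x y, margW2 W x y = BECk e x y)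
    {α : ℝ} (hα0 : 0 ≤ α) (hα1 : α ≤ 1) {R1 R2 : ℝ} (h1 : 0 ≤ R1) (hb : 0 ≤ R2)
    (c1 : R1 = 0 ∨ R1 < 1 - Hb (bconv α p))
    (c2 : R2 = 0 ∨ R2 < (1 - e) * Hb α) (c3 : R1 = 0 ∨ R1 + R2 < 1 - e) :
    Ach0 W (R1, R2) := by
  refine ⟨h1, hb, fun ε hε => ?_⟩
  obtain ⟨A1, a1, d1⟩ := pick_below c1
  obtain ⟨A2, a2, d2⟩ := pick_below c2
  obtain ⟨A3, a3, d3⟩ := pick_below c3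
  obtain ⟨r1, r2, r3, r10, r11, r20, r21, r30, r31, H⟩ :=
    asymp (A1 := 1 - A1) hα0 hα1 hp0 hp1 he0 he1 (by linarith) a2 a3
  have L := (((tendsto_pow_atTop_nhds_zero_of_lt_one r10 r11).add (lim_a h1 d1)).add
    ((((tendsto_pow_atTop_nhds_zero_of_lt_one r20 r21).add
      (tendsto_pow_atTop_nhds_zero_of_lt_one r30 r31)).add (lim_a hb d2)).add (lim_b h1 hb d3)))
  simp only [add_zero] at L
  obtain ⟨n, hn, hn0⟩ := ((L.eventually (gt_mem_nhds hε)).and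
    (Filter.eventually_gt_atTop 0)).exists
  set k := kk R1 n with hk
  set l := kk R2 n with hl
  have k0 : 0 < k := kk_pos _ _
  have l0 : 0 < l := kk_pos _ _
  have : NeZero k := ⟨k0.ne'⟩
  have : NeZero l := ⟨l0.ne'⟩
  have nR : (0:ℝ) < n := by exact_mod_cast hn0
  obtain ⟨x, D1, D2, hD⟩ := H n (Fin k) (Fin l) Unit (fun _ => ()) k (by
    intro c
    simp)
  refine ⟨n, k, l, hn0, k0, l0, fun m => x m.1 m.2, D1, fun y => (D2 (y, ())).2, ?_, ?_, ?_⟩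
  · rw [le_div_iff₀ nR]; exact kk_rate R1 hn0
  · rw [le_div_iff₀ nR]; exact kk_rate R2 hn0
  · refine le_trans ?_ hn.le
    refine le_trans ?_ (hD.trans (le_of_eq ?_))
    · unfold errP0
      simp only [Fintype.card_fin]
      refine mul_le_mul_of_nonneg_left ?_ (by positivity)
      rw [Fintype.sum_prod_type]
      refine Finset.sum_le_sum fun c _ => Finset.sum_le_sum fun s _ => ?_
      set cs := (c, s) with hcs
      have := msg_bound W hW hm1 hm2 n (x cs.1 cs.2)
        (fun y => D1 y.1 = cs.1 ∧ (D2 (y.2, ())).2 = cs.2)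
        (fun y => D1 y ≠ cs.1) (fun y => D2 (y, ()) ≠ (cs.1, cs.2)) (by
          intro y hA hB
          rw [not_not] at hA hB
          simp only [hA, hB, and_self])
      refine le_trans (le_of_eq ?_) this
      refine Finset.sum_congr rfl fun y _ => ?_
      exact congrArg _ (ite01 _)
    · simp only [Fintype.card_fin]
      rw [show (1 - A1 - 1) = - A1 by ring]

end

theorem closure_scale {P : ℝ × ℝ → Prop} {R : ℝ × ℝ}
    (h : ∀ t : ℝ, 0 < t → t < 1 → P (t * R.1, t * R.2)) : R ∈ closure {R | P R} := by
  have c : Filter.Tendsto (fun t : ℝ => (t * R.1, t * R.2)) (nhdsWithin 1 (Set.Iio 1)) (nhds R) := by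
    have : Continuous (fun t : ℝ => (t * R.1, t * R.2)) := by fun_prop
    have := this.tendsto 1
    simp only [one_mul, Prod.mk.eta] at this
    exact this.mono_left nhdsWithin_le_nhds
  refine mem_closure_of_tendsto c ?_
  filter_upwards [Ioo_mem_nhdsLT (zero_lt_one' ℝ)] with t ht
  exact h t ht.1 ht.2

theorem scale_lt {t x b : ℝ} (ht0 : 0 < t) (ht : t < 1) (hx : 0 ≤ x) (hb : x ≤ b) :
    t * x = 0 ∨ t * x < b := by
  rcases hx.eq_or_lt with rfl | h
  · left; simp
  · right; nlinarith

theorem Hb_symm (x : ℝ) : Hb (1 - x) = Hb x := by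
  unfold Hb; rw [sub_sub_cancel]; ring

theorem Hb_bconv_ge {a p : ℝ} (hp0 : 0 ≤ p) (hp : p ≤ 1/2) (h0 : 0 ≤ a) (h1 : a ≤ 1) :
    Hb p ≤ Hb (bconv a p) := by
  have key : ∀ b : ℝ, 0 ≤ b → b ≤ 1/2 → Hb p ≤ Hb (bconv b p) := by
    intro b hb0 hb
    refine Hb_mono hp0 ?_ ?_
    · unfold bconv; nlinarith
    · unfold bconv; nlinarith
  rcases le_total a (1/2) with h | h
  · exact key a h0 h
  · have := key (1 - a) (by linarith) (by linarith)
    rwa [bconv_one_sub, Hb_symm] at this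

theorem R1_le {p e R1 R2 : ℝ} (hp0 : 0 ≤ p) (hp : p ≤ 1/2) (he0 : 0 ≤ e) (he : e ≤ 1)
    (h2 : 0 ≤ R2)
    (out : ∀ l c : ℝ, 1 ≤ l → (∀ a ∈ Set.Icc (0:ℝ) 1, (1 - e) * Hb a - l * Hb (bconv a p) ≤ c) →
      R2 + l * R1 ≤ l + c) : R1 ≤ 1 - Hb p := by
  by_contra hc
  push Not at hc
  set d := R1 - (1 - Hb p) with hd
  have d0 : 0 < d := by linarith
  have := out (1 + 2 / d) ((1 - e) - (1 + 2 / d) * Hb p)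
    (by have : 0 < 2 / d := by positivity
        linarith) (by
      intro a ha
      have h1 := Hb_bconv_ge hp0 hp ha.1 ha.2
      have h3 : (1 - e) * Hb a ≤ 1 - e := mul_le_of_le_one_right (by linarith) (Hb_le_one a)
      have h4 : (1 + 2 / d) * Hb p ≤ (1 + 2 / d) * Hb (bconv a p) :=
        mul_le_mul_of_nonneg_left h1 (by positivity)
      linarith)
  have e1 : (1 + 2 / d) * d = d + 2 := by field_simp
  have e2 : (1 + 2 / d) * R1 = (1 + 2 / d) * d + (1 + 2 / d) - (1 + 2 / d) * Hb p := by
    rw [hd]; ring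
  rw [e1] at e2
  linarith

theorem curve {p e R1 R2 β : ℝ} (hp0 : 0 ≤ p) (hp : p < 1/2) (he0 : 0 ≤ e) (he : e ≤ 1)
    (h2 : 0 ≤ R2) (h2' : R2 ≤ 1 - e)
    (out : ∀ l c : ℝ, 1 ≤ l → (∀ a ∈ Set.Icc (0:ℝ) 1, (1 - e) * Hb a - l * Hb (bconv a p) ≤ c) →
      R2 + l * R1 ≤ l + c)
    (hβ0 : 0 < β) (hβ : β ≤ 1/2)
    (slope : ∀ α, 0 < α → α ≤ β → α < 1/2 → (1 - 2 * p) * Lf (bconv α p) ≤ (1 - e) * Lf α)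
    (hR : 1 - Hb (bconv β p) ≤ R1) :
    ∃ α ∈ Set.Icc (0:ℝ) β, R1 = 1 - Hb (bconv α p) ∧ R2 ≤ (1 - e) * Hb α := by
  have b0 : bconv 0 p = p := by unfold bconv; ring
  have r1 := R1_le hp0 hp.le he0 he h2 out
  have fc : Continuous (fun α => 1 - Hb (bconv α p)) :=
    continuous_const.sub (Hb_cont.comp (bconv_cont p))
  have key : ∀ α, 0 < α → α ≤ β → α < 1/2 → ∃ l, 1 ≤ l ∧
      R2 ≤ (1 - e) * Hb α + l * (1 - R1 - Hb (bconv α p)) := by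
    intro α a0 aβ a1
    have pos : 0 < (1 - 2 * p) * Lf (bconv α p) := by
      rw [Lf_bconv a0 (by linarith) hp0 (by linarith)]
      have k0 : 0 < 1 - 2 * p := by linarith
      have u0 : 0 < 1 - 2 * α := by linarith
      exact mul_pos k0 (At_pos (mul_pos k0 u0) (by nlinarith))
    refine ⟨(1 - e) * Lf α / ((1 - 2 * p) * Lf (bconv α p)), ?_, ?_⟩
    · rw [le_div_iff₀ pos, one_mul]
      exact slope α a0 aβ a1
    · have := out _ _ (by rw [le_div_iff₀ pos, one_mul]; exact slope α a0 aβ a1)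
        (opt (l := (1 - e) * Lf α / ((1 - 2 * p) * Lf (bconv α p))) hp0 hp he a0 a1
          (div_mul_cancel₀ _ pos.ne'))
      linarith
  obtain ⟨α, hα, hf⟩ := intermediate_value_Icc' hβ0.le fc.continuousOn
    (⟨hR, by rw [b0]; exact r1⟩ : R1 ∈ Set.Icc _ _)
  have hf : 1 - Hb (bconv α p) = R1 := hf
  refine ⟨α, hα, hf.symm, ?_⟩
  rcases hα.1.eq_or_lt with h | h
  · subst h
    rw [b0] at hf
    have t : Filter.Tendsto (fun a : ℝ => (1 - e) * Hb a) (nhdsWithin 0 (Set.Ioi 0))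
        (nhds ((1 - e) * Hb 0)) :=
      ((continuous_const.mul Hb_cont).tendsto 0).mono_left nhdsWithin_le_nhds
    refine ge_of_tendsto t ?_
    filter_upwards [Ioo_mem_nhdsGT hβ0] with a ha
    obtain ⟨l, hl, h⟩ := key a ha.1 ha.2.le (by linarith [ha.2])
    have := Hb_bconv_ge hp0 hp.le ha.1.le (by linarith [ha.2] : a ≤ 1)
    nlinarith
  · rcases (hα.2.trans hβ).eq_or_lt with h' | h'
    · rw [h', Hb_half, mul_one]; exact h2'
    · obtain ⟨l, hl, hk⟩ := key α h hα.2 h'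
      have : 1 - R1 - Hb (bconv α p) = 0 := by linarith
      rw [this, mul_zero, add_zero] at hk
      exact hk

theorem inner2 {p e : ℝ} (hp0 : 0 ≤ p) (hp1 : p ≤ 1) (he0 : 0 ≤ e) (he1 : e ≤ 1)
    (W : Bool → Bool × Option Bool → ℝ) (hW : IsChannel W)
    (hm1 : ∀ x y, margW1 W x y = BSCk p x y) (hm2 : ∀ x y, margW2 W x y = BECk e x y)
    {α : ℝ} (hα0 : 0 ≤ α) (hα1 : α ≤ 1) {R1 Ra Rb : ℝ} (h1 : 0 ≤ R1) (ha : 0 ≤ Ra) (hb : 0 ≤ Rb)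
    (c1 : R1 + Ra ≤ 1 - Hb (bconv α p)) (c2 : Rb ≤ (1 - e) * Hb α) (c3 : Ra + Rb ≤ 1 - e) :
    (R1, Ra + Rb) ∈ Cap2 W := by
  refine closure_scale fun t t0 t1 => ?_
  have := ach2 W hp0 hp1 he0 he1 hW hm1 hm2 hα0 hα1 (mul_nonneg t0.le h1) (mul_nonneg t0.le ha)
    (mul_nonneg t0.le hb) (by rw [← mul_add]; exact scale_lt t0 t1 (by linarith) c1)
    (scale_lt t0 t1 hb c2) (by
      have := scale_lt t0 t1 (by linarith : 0 ≤ Ra + Rb) c3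
      rw [← mul_add]
      rcases this with h | h
      · left
        have : Ra + Rb = 0 := by
          rcases mul_eq_zero.1 h with h | h
          · linarith
          · exact h
        rw [show Ra = 0 by linarith]; simp
      · exact Or.inr h)
  rw [← mul_add] at this
  exact this

theorem inner0 {p e : ℝ} (hp0 : 0 ≤ p) (hp1 : p ≤ 1) (he0 : 0 ≤ e) (he1 : e ≤ 1)
    (W : Bool → Bool × Option Bool → ℝ) (hW : IsChannel W)
    (hm1 : ∀ x y, margW1 W x y = BSCk p x y) (hm2 : ∀ x y, margW2 W x y = BECk e x y)
    {α : ℝ} (hα0 : 0 ≤ α) (hα1 : α ≤ 1) {R : ℝ × ℝ} (h1 : 0 ≤ R.1) (hb : 0 ≤ R.2)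
    (c1 : R.1 ≤ 1 - Hb (bconv α p)) (c2 : R.2 ≤ (1 - e) * Hb α) (c3 : R.1 + R.2 ≤ 1 - e) :
    R ∈ Cap W := by
  refine closure_scale fun t t0 t1 => ?_
  refine ach0 W hp0 hp1 he0 he1 hW hm1 hm2 hα0 hα1 (mul_nonneg t0.le h1)
    (mul_nonneg t0.le hb) (scale_lt t0 t1 h1 c1)
    (scale_lt t0 t1 hb c2) ?_
  have := scale_lt t0 t1 (by linarith : 0 ≤ R.1 + R.2) c3
  rw [← mul_add]
  rcases this with h | h
  · left
    have : R.1 + R.2 = 0 := by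
      rcases mul_eq_zero.1 h with h | h
      · linarith
      · exact h
    rw [show R.1 = 0 by linarith]; simp
  · exact Or.inr h

theorem root_iff {p e a : ℝ} (hp0 : 0 ≤ p) (hp : p ≤ 1/2) (ha : a ∈ Set.Ioo (0:ℝ) (1/2)) :
    (1 - 2*p) * Real.logb 2 ((1 - bconv a p) / bconv a p)
          = (1 - e) * Real.logb 2 ((1 - a) / a) ↔
    (1 - 2 * p) * Lf (bconv a p) = (1 - e) * Lf a := by
  have b := bconv_pos ha.1 (by linarith [ha.2]) hp0 (by linarith)
  have l2 : Real.log 2 ≠ 0 := (Real.log_pos (by norm_num)).ne'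
  rw [logb_eq b.1 b.2, logb_eq ha.1 (by linarith [ha.2]), ← mul_div_assoc, ← mul_div_assoc]
  exact div_left_inj' l2

theorem Ach0_Ach2 {W : Bool → Bool × Option Bool → ℝ} {R : ℝ × ℝ} (h : Ach0 W R) : Ach2 W R := by
  refine ⟨h.1, h.2.1, fun ε hε => ?_⟩
  obtain ⟨n, k1, k2, hn, h1, h2, f, g1, g2, r1, r2, he⟩ := h.2.2 ε hε
  exact ⟨n, k1, k2, hn, h1, h2, f, g1, fun y => g2 y.1, r1, r2, he⟩

theorem bscbec_cap2
    (p e : ℝ) (hp0 : 0 ≤ p) (hp : p ≤ 1/2) (he0 : 0 ≤ e) (he : e ≤ 1)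
    (W : Bool → Bool × Option Bool → ℝ) (hW : IsChannel W)
    (hm1 : ∀ x y, margW1 W x y = BSCk p x y)
    (hm2 : ∀ x y, margW2 W x y = BECk e x y) :
    (e ≤ 4 * p * (1 - p) → Cap2 W = Cap W) ∧
    (4 * p * (1 - p) < e → e < 1 → p ≠ 0 →
      (∃! a : ℝ, a ∈ Set.Ioo (0:ℝ) (1/2) ∧
        (1 - 2*p) * Real.logb 2 ((1 - bconv a p) / bconv a p)
          = (1 - e) * Real.logb 2 ((1 - a) / a)) ∧
      (∀ a ∈ Set.Ioo (0:ℝ) (1/2),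
        (1 - 2*p) * Real.logb 2 ((1 - bconv a p) / bconv a p)
            = (1 - e) * Real.logb 2 ((1 - a) / a) →
        Cap2 W = {R : ℝ × ℝ | 0 ≤ R.1 ∧ 0 ≤ R.2 ∧
          ((∃ α ∈ Set.Icc (0:ℝ) a,
              R.1 ≤ 1 - Hb (bconv α p) ∧ R.2 ≤ (1 - e) * Hb α) ∨
           (R.1 ≤ 1 - Hb (bconv a p) ∧ R.2 ≤ 1 - e ∧
              R.1 + R.2 ≤ 1 - Hb (bconv a p) + (1 - e) * Hb a))})) ∧
    (e = 1 ∨ p = 0 →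
      Cap2 W = {R : ℝ × ℝ | 0 ≤ R.1 ∧ 0 ≤ R.2 ∧
        R.2 ≤ 1 - e ∧ R.1 + R.2 ≤ 1 - Hb p}) := by
  have hp1 : p ≤ 1 := by linarith
  have b0 : bconv 0 p = p := by unfold bconv; ring
  refine ⟨?_, ?_, ?_⟩
  · intro hep
    refine Set.Subset.antisymm ?_ (closure_mono fun R hR => Ach0_Ach2 hR)
    intro R hR
    obtain ⟨h1, h2, h2', out⟩ := outer hp0 hp1 he0 he W hW hm1 hm2 R hR
    obtain ⟨α, hα, e1, e2⟩ : ∃ α ∈ Set.Icc (0:ℝ) (1/2), R.1 = 1 - Hb (bconv α p) ∧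
        R.2 ≤ (1 - e) * Hb α := by
      rcases hp.eq_or_lt with h | h
      · refine ⟨1/2, ⟨by norm_num, le_rfl⟩, ?_, by rw [Hb_half, mul_one]; exact h2'⟩
        have r := R1_le hp0 hp he0 he h2 out
        have : bconv (1/2) p = 1/2 := by unfold bconv; ring
        rw [this, Hb_half]
        rw [h, Hb_half] at r
        linarith
      · refine curve hp0 h he0 he h2 h2' out (by norm_num) le_rfl
          (fun α a0 _ a1 => slope_ge hp0 hp hep a0 a1.le) ?_
        have : bconv (1/2) p = 1/2 := by unfold bconv; ring
        rw [this, Hb_half]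
        linarith
    have := sum_le hp0 hp hep hα.1 hα.2
    exact inner0 hp0 hp1 he0 he W hW hm1 hm2 hα.1 (by linarith [hα.2]) h1 h2 e1.le e2
      (by linarith)
  · intro hep he1 hpne
    have hp0' : 0 < p := lt_of_le_of_ne hp0 hpne.symm
    have hp' : p < 1/2 := by
      rcases hp.eq_or_lt with rfl | h
      · norm_num at hep; linarith
      · exact h
    constructor
    · obtain ⟨a, ⟨ha, hea⟩, hu⟩ := exists_root hp0' hp hep he1
      refine ⟨a, ⟨ha, (root_iff hp0 hp ha).2 hea⟩, ?_⟩
      rintro b ⟨hb, heb⟩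
      exact hu b ⟨hb, (root_iff hp0 hp hb).1 heb⟩
    · intro a ha hroot
      rw [root_iff hp0 hp ha] at hroot
      have H0 : 0 ≤ (1 - e) * Hb a :=
        mul_nonneg (by linarith) (Hb_nonneg ha.1.le (by linarith [ha.2]))
      refine Set.Subset.antisymm ?_ ?_
      · intro R hR
        obtain ⟨h1, h2, h2', out⟩ := outer hp0 hp1 he0 he W hW hm1 hm2 R hR
        refine ⟨h1, h2, ?_⟩
        rcases le_total R.1 (1 - Hb (bconv a p)) with h | h
        · right
          refine ⟨h, h2', ?_⟩
          have := out 1 _ le_rfl (opt (l := 1) hp0 hp' he ha.1 ha.2 (by rw [one_mul]; exact hroot))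
          linarith
        · left
          obtain ⟨α, hα, e1, e2⟩ := curve hp0 hp' he0 he h2 h2' out ha.1 ha.2.le (by
            intro α a0 aa a1
            rw [Lf_bconv ha.1 (by linarith [ha.2]) hp0 hp1, Lf_eq ha.1 (by linarith [ha.2])] at hroot
            rw [Lf_bconv a0 (by linarith) hp0 hp1, Lf_eq a0 (by linarith)]
            have cr := At_cross (k := 1 - 2 * p) (u := 1 - 2 * α) (v := 1 - 2 * a) (by linarith)
              (by linarith) (by linarith [ha.2]) (by linarith) (by linarith)
            have pv := At_pos (u := 1 - 2 * a) (by linarith [ha.2]) (by linarith [ha.1])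
            refine le_of_mul_le_mul_right ?_ pv
            have c2 := mul_le_mul_of_nonneg_left cr (by linarith : 0 ≤ 1 - 2 * p)
            calc _ = (1 - 2 * p) * (At ((1 - 2 * p) * (1 - 2 * α)) * At (1 - 2 * a)) := by ring
              _ ≤ _ := c2
              _ = ((1 - 2 * p) * At ((1 - 2 * p) * (1 - 2 * a))) * At (1 - 2 * α) := by ring
              _ = _ := by rw [hroot]; ring) h
          exact ⟨α, hα, e1.le, e2⟩
      · rintro ⟨R1, R2⟩ ⟨h1, h2, h⟩
        simp only at h1 h2 h
        rcases h with ⟨α, hα, e1, e2⟩ | ⟨e1, e2, e3⟩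
        · have := inner2 hp0 hp1 he0 he W hW hm1 hm2 hα.1 (by linarith [hα.2, ha.2]) h1 le_rfl h2
            (by linarith) e2 (by
              have : (1 - e) * Hb α ≤ 1 - e := mul_le_of_le_one_right (by linarith) (Hb_le_one α)
              linarith)
          rwa [zero_add] at this
        · rcases le_total R2 ((1 - e) * Hb a) with h | h
          · have := inner2 hp0 hp1 he0 he W hW hm1 hm2 ha.1.le (by linarith [ha.2]) h1 le_rfl h2
              (by linarith) h (by linarith)
            rwa [zero_add] at this
          · have := inner2 hp0 hp1 he0 he W hW hm1 hm2 ha.1.le (by linarith [ha.2]) h1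
              (sub_nonneg.2 h) H0 (by linarith) le_rfl (by linarith)
            rwa [sub_add_cancel] at this
  · intro hc
    refine Set.Subset.antisymm ?_ ?_
    · intro R hR
      obtain ⟨h1, h2, h2', out⟩ := outer hp0 hp1 he0 he W hW hm1 hm2 R hR
      refine ⟨h1, h2, h2', ?_⟩
      have := out 1 (- Hb p) le_rfl (by
        intro a ha
        have g := Hb_bconv_ge hp0 hp ha.1 ha.2
        rcases hc with rfl | rfl
        · linarith
        · have : bconv a 0 = a := by unfold bconv; ring
          rw [this, Hb_zero]
          have := mul_nonneg he0 (Hb_nonneg ha.1 ha.2)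
          linarith)
      linarith
    · rintro ⟨R1, R2⟩ ⟨h1, h2, h3, h4⟩
      simp only at h1 h2 h3 h4
      have := inner2 hp0 hp1 he0 he W hW hm1 hm2 le_rfl (by norm_num) h1 h2 le_rfl
        (by rw [b0]; exact h4) (by rw [Hb_zero, mul_zero]) (by linarith)
      rwa [add_zero] at this

end
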